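/- arXiv:0808.1199 — 2 statements merged into one kernel-verified Lean document; each statement's English description precedes it below -/
import Mathlib

section
/- For every positive integer N, the N-fold Cartesian product of the complete graph K₅ with itself (as a topological space, i.e. the product of the underlying 1-dimensional polyhedra) does not embed topologically into ℝ^{2N}. -/
open Set

noncomputable section

/-- The point of `ℝ^V` corresponding to a vertex `v` of a graph. -/
def vert {V : Type*} [DecidableEq V] (v : V) : V → ℝ := fun i => if i = v then 1 else 0

/-- Geometric realization of a simple graph as a subset of `ℝ^V`:
the union of the straight segments joining the standard points of adjacent vertices. -/
def graphRealization {V : Type*} [DecidableEq V] (G : SimpleGraph V) : Set (V → ℝ) :=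
  ⋃ p : {p : V × V // G.Adj p.1 p.2}, segment ℝ (vert p.1.1) (vert p.1.2)

/-- A (compact) polyhedron: a finite union of polytopes (convex hulls of finite sets). -/
def IsPolyhedron {E : Type*} [AddCommGroup E] [Module ℝ E] (s : Set E) : Prop :=
  ∃ T : Set (Set E), T.Finite ∧ (∀ P ∈ T, ∃ Q : Set E, Q.Finite ∧ P = convexHull ℝ Q) ∧
    s = ⋃₀ T

/-- `f` is piecewise linear (PL) on `s`: there is a finite family of polytopes covering `s`
on each of which `f` coincides with an affine map. -/
def IsPLOn {E F : Type*} [AddCommGroup E] [Module ℝ E] [AddCommGroup F] [Module ℝ F]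
    (f : E → F) (s : Set E) : Prop :=
  ∃ T : Set (Set E), T.Finite ∧ (∀ P ∈ T, ∃ Q : Set E, Q.Finite ∧ P = convexHull ℝ Q) ∧
    s ⊆ ⋃₀ T ∧ ∀ P ∈ T, ∃ g : E →ᵃ[ℝ] F, EqOn f g (P ∩ s)

/-- The cone over a set `A` with apex `p` (union of segments from `p` to points of `A`). -/
def coneFrom {E : Type*} [AddCommGroup E] [Module ℝ E] (p : E) (A : Set E) : Set E :=
  ⋃ x ∈ A, segment ℝ p x

namespace K5Power

open MvPolynomial

/-! ### Fan's alternating cochain on simplices with signed labels -/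

/-- The indicator of the list of signs being `e, !e, e, …`. -/
def alternates : Bool → List Bool → ZMod 2
  | _, [] => 1
  | e, b :: l => if b = e then alternates (!e) l else 0

/-- The facets of a simplex given as a list of vertices. -/
def facets {α : Type*} : List α → List (List α)
  | [] => []
  | x :: l => l :: (facets l).map (x :: ·)

lemma sublist_of_mem_facets {α : Type*} {l l' : List α} (h : l' ∈ facets l) :
    l'.Sublist l := by
  induction l generalizing l' with
  | nil => simp [facets] at h
  | cons x l ih =>
    simp only [facets, List.mem_cons, List.mem_map] at h
    rcases h with rfl | ⟨l'', h, rfl⟩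
    · exact List.sublist_cons_self _ _
    · exact (ih h).cons_cons x

lemma facets_map {α β : Type*} (f : α → β) (l : List α) :
    facets (l.map f) = (facets l).map (List.map f) := by
  induction l with
  | nil => rfl
  | cons x l ih => simp [facets, ih]

lemma alternates_cons_add (b : Bool) (l : List Bool) :
    alternates true (b :: l) + alternates false (b :: l) = alternates (!b) l := by
  cases b <;> simp [alternates]

lemma sum_facets_alternates (e : Bool) (l : List Bool) :
    ((facets l).map (alternates e)).sum = alternates true l + alternates false l := by
  induction l generalizing e with
  | nil => simp [facets, alternates]; decide
  | cons b l ih =>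
    rw [alternates_cons_add]
    by_cases h : b = e
    · subst h
      have : (alternates b ∘ fun x => b :: x) = alternates (!b) := by
        funext x; simp [alternates]
      simp only [facets, List.map_cons, List.sum_cons, List.map_map, this, ih]
      cases b <;> grind
    · have : (alternates e ∘ fun x => b :: x) = fun _ => 0 := by
        funext x; simp [alternates, h]
      have hb : (!b) = e := by cases b <;> cases e <;> simp_all
      simp [facets, List.map_cons, List.sum_cons, List.map_map, this, hb]

/-- Signs of a list of labels. -/
def signs (l : List ℤ) : List Bool := l.map fun x => decide (0 < x)

/-- No two labels are opposite (in particular no label is zero). -/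
def NoOpposite (l : List ℤ) : Prop := ∀ x ∈ l, ∀ y ∈ l, x + y ≠ 0

/-- The labels sorted by absolute value. -/
def sortAbs (m : Multiset ℤ) : List ℤ :=
  m.toList.mergeSort fun a b => decide (a.natAbs ≤ b.natAbs)

lemma pairwise_sortAbs (m : Multiset ℤ) :
    (sortAbs m).Pairwise fun a b => a.natAbs ≤ b.natAbs := by
  have := List.pairwise_mergeSort (le := fun a b : ℤ => decide (a.natAbs ≤ b.natAbs))
    (by intro a b c; simpa using le_trans) (by intro a b; simpa using le_total _ _) m.toList
  simpa [sortAbs] using this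

lemma sortAbs_perm (l : List ℤ) : (sortAbs l).Perm l :=
  (List.mergeSort_perm _ _).trans (Multiset.coe_eq_coe.1 (Multiset.coe_toList _))

lemma NoOpposite.sortAbs_eq {l : List ℤ} (h : NoOpposite l)
    (hl : l.Pairwise fun a b => a.natAbs ≤ b.natAbs) : sortAbs l = l := by
  refine List.Perm.eq_of_pairwise ?_ (pairwise_sortAbs l) hl (sortAbs_perm l)
  intro a b ha hb hab hba
  have := h a ((sortAbs_perm l).mem_iff.1 ha) b hb
  omega

/-- Fan's cochain: the indicator of simplices whose labels, sorted by absolute value,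
have signs `+, -, +, …`. -/
def fan : MvPolynomial ℤ (ZMod 2) →ₗ[ZMod 2] ZMod 2 :=
  (basisMonomials ℤ (ZMod 2)).constr (ZMod 2) fun s =>
    alternates true (signs (sortAbs (Finsupp.toMultiset s)))

/-- A simplex with given vertex labels, as a monomial. -/
def simplex (l : List ℤ) : MvPolynomial ℤ (ZMod 2) := (l.map X).prod

lemma simplex_perm {l l' : List ℤ} (h : l.Perm l') : simplex l = simplex l' :=
  (h.map X).prod_eq

lemma simplex_eq_monomial (l : List ℤ) :
    simplex l = monomial (Multiset.toFinsupp (l : Multiset ℤ)) 1 := by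
  induction l with
  | nil => simp [simplex]
  | cons x l ih =>
    rw [simplex, List.map_cons, List.prod_cons, ← simplex, ih, ← Multiset.cons_coe,
      ← Multiset.singleton_add, Multiset.toFinsupp_add, Multiset.toFinsupp_singleton, X,
      monomial_mul, one_mul]

lemma fan_simplex (l : List ℤ) :
    fan (simplex l) = alternates true (signs (sortAbs l)) := by
  rw [simplex_eq_monomial, fan]
  have := (basisMonomials ℤ (ZMod 2)).constr_basis (ZMod 2) (fun s =>
    alternates true (signs (sortAbs (Finsupp.toMultiset s)))) (Multiset.toFinsupp (l : Multiset ℤ))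
  simpa using this

lemma fan_simplex_of_sorted {l : List ℤ} (h : NoOpposite l)
    (hl : l.Pairwise fun a b => a.natAbs ≤ b.natAbs) :
    fan (simplex l) = alternates true (signs l) := by
  rw [fan_simplex, h.sortAbs_eq hl]

/-- The (augmented) simplicial boundary. -/
def bdry : Derivation (ZMod 2) (MvPolynomial ℤ (ZMod 2)) (MvPolynomial ℤ (ZMod 2)) :=
  mkDerivation (ZMod 2) fun _ => 1

lemma bdry_X_mul (x : ℤ) (p : MvPolynomial ℤ (ZMod 2)) :
    bdry (X x * p) = p + X x * bdry p := by
  rw [Derivation.leibniz, bdry, mkDerivation_X]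
  simp [add_comm]

lemma bdry_simplex (l : List ℤ) : bdry (simplex l) = ((facets l).map simplex).sum := by
  induction l with
  | nil => simp [simplex, facets]
  | cons x l ih =>
    have : (simplex ∘ fun y => x :: y) = fun y => X x * simplex y := by
      funext y; simp [simplex]
    rw [simplex, List.map_cons, List.prod_cons, ← simplex, bdry_X_mul, ih, facets, List.map_cons,
      List.sum_cons, List.map_map, this, List.sum_map_mul_left]

lemma alternates_map_not (e : Bool) (l : List Bool) :
    alternates e (l.map (!·)) = alternates (!e) l := by
  induction l generalizing e with
  | nil => rfl
  | cons b l ih => cases b <;> cases e <;> simp [alternates, ih]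

lemma fan_bdry_simplex {l : List ℤ} (h : NoOpposite l) :
    fan (bdry (simplex l)) = fan (simplex l) + fan (rename Neg.neg (simplex l)) := by
  have hp := sortAbs_perm l
  have hs := pairwise_sortAbs (l : Multiset ℤ)
  rw [← simplex_perm hp]
  have h' : NoOpposite (sortAbs l) := fun x hx y hy => h x (hp.mem_iff.1 hx) y (hp.mem_iff.1 hy)
  generalize sortAbs l = l at hs h'
  clear hp h
  have hneg : rename Neg.neg (simplex l) = simplex (l.map Neg.neg) := by
    rw [simplex, map_list_prod, simplex, List.map_map, List.map_map]
    congr 1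
    apply List.map_congr_left
    simp
  have hsig : signs (l.map Neg.neg) = (signs l).map (!·) := by
    rw [signs, signs, List.map_map, List.map_map]
    apply List.map_congr_left
    intro x hx
    have := h' x hx x hx
    simp only [Function.comp]
    by_cases h0 : 0 < x <;> simp [h0] <;> omega
  rw [hneg, fan_simplex_of_sorted h' hs, fan_simplex_of_sorted, hsig, alternates_map_not,
    bdry_simplex, map_list_sum, List.map_map]
  · have : ∀ l' ∈ facets l, (fan ∘ simplex) l' = alternates true (signs l') := by
      intro l' hl'
      have hsub := sublist_of_mem_facets hl'
      exact fan_simplex_of_sorted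
        (fun x hx y hy => h' x (hsub.subset hx) y (hsub.subset hy)) (hs.sublist hsub)
    rw [List.map_congr_left this, Bool.not_true, ← sum_facets_alternates true, signs, facets_map,
      List.map_map]
    rfl
  · intro x hx y hy
    simp only [List.mem_map] at hx hy
    obtain ⟨x, hx, rfl⟩ := hx
    obtain ⟨y, hy, rfl⟩ := hy
    have := h' x hx y hy
    omega
  · rw [List.pairwise_map]
    simpa using hs

lemma fan_simplex_eq_zero {l : List ℤ} {n : ℕ} (h : NoOpposite l) (hn : ∀ x ∈ l, x.natAbs ≤ n)
    (hl : n < l.length) : fan (simplex l) = 0 := by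
  have hp := sortAbs_perm l
  have hs := pairwise_sortAbs (l : Multiset ℤ)
  rw [fan_simplex]
  have h' : NoOpposite (sortAbs l) := fun x hx y hy => h x (hp.mem_iff.1 hx) y (hp.mem_iff.1 hy)
  replace hn : ∀ x ∈ sortAbs l, x.natAbs ≤ n := fun x hx => hn x (hp.mem_iff.1 hx)
  rw [← hp.length_eq] at hl
  generalize sortAbs l = l at hs h' hn hl
  clear hp h
  suffices key : ∀ (l : List ℤ) (k : ℕ) (e : Bool), k ≤ n → NoOpposite l →
      l.Pairwise (fun a b => a.natAbs ≤ b.natAbs) →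
      (∀ x ∈ l, k ≤ x.natAbs ∧ x.natAbs ≤ n ∧ (x.natAbs = k → decide (0 < x) = !e)) →
      n < l.length + k → alternates e (signs l) = 0 by
    refine key l 0 true (by omega) h' hs (fun x hx => ⟨by omega, hn x hx, fun h0 => ?_⟩)
      (by simpa using hl)
    have := h' x hx x hx
    omega
  clear h' hs hn hl l
  intro l
  induction l with
  | nil =>
    intro k e hk _ _ _ hl
    simp at hl
    omega
  | cons x l ih =>
    intro k e _ hop hs hb hl
    rw [signs, List.map_cons, ← signs, alternates]
    split_ifs with hx
    · rw [List.pairwise_cons] at hs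
      obtain ⟨hk, hxn, hxe⟩ := hb x (by simp)
      have hkx : k ≠ x.natAbs := fun h => by
        have := hxe h.symm
        rw [hx] at this
        cases e <;> simp at this
      refine ih x.natAbs (!e) hxn
        (fun y hy z hz => hop y (List.mem_cons_of_mem _ hy) z (List.mem_cons_of_mem _ hz)) hs.2 ?_ ?_
      · intro y hy
        refine ⟨hs.1 y hy, (hb y (List.mem_cons_of_mem _ hy)).2.1, fun hyx => ?_⟩
        have := hop x (by simp) y (List.mem_cons_of_mem _ hy)
        have : y = x := by omega
        rw [this, hx, Bool.not_not]
      · simp only [List.length_cons] at hl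
        omega
    · rfl

/-! ### Chains with coefficients modulo 2 -/

/-- Formal sums modulo 2. -/
abbrev Chain (α : Type*) := α →₀ ZMod 2

/-- A basis chain. -/
abbrev basic {α : Type*} (a : α) : Chain α := Finsupp.single a 1

/-- Chains supported in a set. -/
abbrev chainsIn {α : Type*} (S : Set α) : Submodule (ZMod 2) (Chain α) :=
  Finsupp.supported (ZMod 2) (ZMod 2) S

/-- The linear extension of a map on basis elements. -/
abbrev extend {α M : Type*} [AddCommGroup M] [Module (ZMod 2) M] (f : α → M) :
    Chain α →ₗ[ZMod 2] M :=
  Finsupp.linearCombination (ZMod 2) f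

/-- The bilinear extension of a binary operation. -/
def bilin {α β γ : Type*} (f : α → β → γ) : Chain α →ₗ[ZMod 2] Chain β →ₗ[ZMod 2] Chain γ :=
  extend fun a => Finsupp.lmapDomain (ZMod 2) (ZMod 2) (f a)

section Chains

variable {α β γ M : Type*} [AddCommGroup M] [Module (ZMod 2) M]

lemma add_self_eq_zero_of_zmod_two (x : M) : x + x = 0 := by
  rw [← two_smul (ZMod 2) x, show (2 : ZMod 2) = 0 from rfl, zero_smul]

lemma extend_basic (f : α → M) (a : α) : extend f (basic a) = f a := by
  simp [extend]

lemma bilin_basic (f : α → β → γ) (a : α) (b : β) :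
    bilin f (basic a) (basic b) = basic (f a b) := by
  simp [bilin, extend]

lemma basic_mem {S : Set α} {a : α} (h : a ∈ S) : basic a ∈ chainsIn S :=
  Finsupp.single_mem_supported _ _ h

lemma map_mem_of_forall_basic {S : Set α} (L : Chain α →ₗ[ZMod 2] M) (N : Submodule (ZMod 2) M)
    (h : ∀ a ∈ S, L (basic a) ∈ N) {c : Chain α} (hc : c ∈ chainsIn S) : L c ∈ N := by
  rw [chainsIn, Finsupp.supported_eq_span_single] at hc
  have : Submodule.span (ZMod 2) ((fun i => Finsupp.single i 1) '' S) ≤ N.comap L := by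
    rw [Submodule.span_le]
    rintro _ ⟨a, ha, rfl⟩
    exact h a ha
  exact this hc

lemma eq_of_forall_basic {S : Set α} (L L' : Chain α →ₗ[ZMod 2] M)
    (h : ∀ a ∈ S, L (basic a) = L' (basic a)) {c : Chain α} (hc : c ∈ chainsIn S) :
    L c = L' c := by
  rw [chainsIn, Finsupp.supported_eq_span_single] at hc
  refine LinearMap.eqOn_span ?_ hc
  rintro _ ⟨a, ha, rfl⟩
  exact h a ha

lemma linearMap_ext_basic {L L' : Chain α →ₗ[ZMod 2] M}
    (h : ∀ a, L (basic a) = L' (basic a)) : L = L' := by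
  ext a
  exact h a

lemma bilin_mem {S : Set α} {S' : Set β} {S'' : Set γ} {f : α → β → γ}
    (h : ∀ a ∈ S, ∀ b ∈ S', f a b ∈ S'') {p : Chain α} (hp : p ∈ chainsIn S)
    {q : Chain β} (hq : q ∈ chainsIn S') : bilin f p q ∈ chainsIn S'' := by
  refine map_mem_of_forall_basic ((bilin f).flip q) _ (fun a ha => ?_) hp
  refine map_mem_of_forall_basic (bilin f (basic a)) _ (fun b hb => ?_) hq
  rw [bilin_basic]
  exact basic_mem (h a ha b hb)

lemma chainsIn_mono {S S' : Set α} (h : S ⊆ S') {c : Chain α} (hc : c ∈ chainsIn S) :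
    c ∈ chainsIn S' :=
  Finsupp.supported_mono h hc

end Chains

/-! ### Cells of a power of a graph -/

/-- A vertex or an edge of a subdivided graph with vertices in `P`. -/
inductive Cell (P : Type*) where
  | pt (u : P) : Cell P
  | seg (u w : P) : Cell P

namespace Cell

variable {P : Type*}

/-- The dimension of a cell. -/
def dim : Cell P → ℕ
  | pt _ => 0
  | seg _ _ => 1

/-- The initial vertex of a cell. -/
def bot : Cell P → P
  | pt u => u
  | seg u _ => u

/-- The set of vertices of a cell. -/
def ends : Cell P → Set P
  | pt u => {u}
  | seg u w => {u, w}

lemma bot_mem_ends (p : Cell P) : p.bot ∈ p.ends := by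
  cases p <;> simp [bot, ends]

end Cell

/-- A product of two cells. -/
abbrev Cell₂ (P : Type*) := Cell P × Cell P

section Words

variable {P : Type*}

/-- The initial vertex of an edge, as a chain. -/
def botFace : Chain (Cell P) →ₗ[ZMod 2] Chain (Cell P) :=
  extend fun
    | .pt _ => 0
    | .seg u _ => basic (.pt u)

/-- The terminal vertex of an edge, as a chain. -/
def topFace : Chain (Cell P) →ₗ[ZMod 2] Chain (Cell P) :=
  extend fun
    | .pt _ => 0
    | .seg _ w => basic (.pt w)

/-- The product of chains of cells. -/
abbrev tens : Chain (Cell P) →ₗ[ZMod 2] Chain (Cell P) →ₗ[ZMod 2] Chain (Cell₂ P) :=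
  bilin Prod.mk

/-- The product of a chain of pairs of cells with a chain of words. -/
abbrev cons :
    Chain (Cell₂ P) →ₗ[ZMod 2] Chain (List (Cell₂ P)) →ₗ[ZMod 2] Chain (List (Cell₂ P)) :=
  bilin List.cons

/-- Extension of an operator on cells to pairs of cells by the Leibniz rule. -/
def leibniz₂ (δ : Chain (Cell P) →ₗ[ZMod 2] Chain (Cell P)) :
    Chain (Cell₂ P) →ₗ[ZMod 2] Chain (Cell₂ P) :=
  extend fun x => tens (δ (basic x.1)) (basic x.2) + tens (basic x.1) (δ (basic x.2))

/-- Extension of an operator on cells to a word of pairs of cells by the Leibniz rule. -/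
def leibnizWord (δ : Chain (Cell P) →ₗ[ZMod 2] Chain (Cell P)) :
    List (Cell₂ P) → Chain (List (Cell₂ P))
  | [] => 0
  | x :: w => cons (leibniz₂ δ (basic x)) (basic w) + cons (basic x) (leibnizWord δ w)

/-- Extension of an operator on cells to words of pairs of cells by the Leibniz rule. -/
def leibniz (δ : Chain (Cell P) →ₗ[ZMod 2] Chain (Cell P)) :
    Chain (List (Cell₂ P)) →ₗ[ZMod 2] Chain (List (Cell₂ P)) :=
  extend (leibnizWord δ)

variable (δ δ' : Chain (Cell P) →ₗ[ZMod 2] Chain (Cell P))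

lemma leibniz₂_tens (p q : Chain (Cell P)) :
    leibniz₂ δ (tens p q) = tens (δ p) q + tens p (δ q) := by
  have : (tens.compr₂ (leibniz₂ δ)) = tens.comp δ + tens.compl₂ δ := by
    refine linearMap_ext_basic fun a => linearMap_ext_basic fun b => ?_
    simp [leibniz₂, bilin_basic, extend_basic, -Finsupp.linearCombination_single]
  exact LinearMap.congr_fun₂ this p q

lemma leibniz_cons (x : Chain (Cell₂ P)) (c : Chain (List (Cell₂ P))) :
    leibniz δ (cons x c) = cons (leibniz₂ δ x) c + cons x (leibniz δ c) := by
  have : (cons.compr₂ (leibniz δ)) = cons.comp (leibniz₂ δ) + cons.compl₂ (leibniz δ) := by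
    refine linearMap_ext_basic fun a => linearMap_ext_basic fun b => ?_
    simp [leibniz, leibnizWord, bilin_basic, extend_basic, -Finsupp.linearCombination_single]
  exact LinearMap.congr_fun₂ this x c

lemma tens_induction {L L' : Chain (Cell₂ P) →ₗ[ZMod 2] Chain (Cell₂ P)}
    (h : ∀ p q, L (tens p q) = L' (tens p q)) (x : Chain (Cell₂ P)) : L x = L' x := by
  suffices L = L' by rw [this]
  refine linearMap_ext_basic fun a => ?_
  have := h (basic a.1) (basic a.2)
  rwa [bilin_basic] at this

lemma word_induction {M : Type*} [AddCommGroup M] [Module (ZMod 2) M]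
    {L L' : Chain (List (Cell₂ P)) →ₗ[ZMod 2] M}
    (h0 : L (basic []) = L' (basic []))
    (h : ∀ x c, L c = L' c → L (cons x c) = L' (cons x c)) (c : Chain (List (Cell₂ P))) :
    L c = L' c := by
  suffices L = L' by rw [this]
  refine linearMap_ext_basic fun w => ?_
  induction w with
  | nil => exact h0
  | cons x w ih =>
    have := h (basic x) (basic w) ih
    rwa [bilin_basic] at this

lemma leibniz_nil : leibniz δ (basic []) = 0 := by
  simp [leibniz, leibnizWord]

lemma leibniz₂_comm (h : ∀ p, δ (δ' p) = δ' (δ p)) (x : Chain (Cell₂ P)) :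
    leibniz₂ δ (leibniz₂ δ' x) = leibniz₂ δ' (leibniz₂ δ x) := by
  refine tens_induction (L := leibniz₂ δ ∘ₗ leibniz₂ δ') (L' := leibniz₂ δ' ∘ₗ leibniz₂ δ)
    (fun p q => ?_) x
  simp only [LinearMap.comp_apply, leibniz₂_tens, map_add, h]
  abel

lemma leibniz_comm (h : ∀ p, δ (δ' p) = δ' (δ p)) (c : Chain (List (Cell₂ P))) :
    leibniz δ (leibniz δ' c) = leibniz δ' (leibniz δ c) := by
  refine word_induction (L := leibniz δ ∘ₗ leibniz δ') (L' := leibniz δ' ∘ₗ leibniz δ)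
    (by simp [leibniz_nil, -Finsupp.linearCombination_single]) (fun x c hc => ?_) c
  simp only [LinearMap.comp_apply] at hc ⊢
  simp only [leibniz_cons, map_add, hc, leibniz₂_comm _ _ h]
  abel

lemma leibniz₂_sq (h : ∀ p, δ (δ p) = 0) (x : Chain (Cell₂ P)) :
    leibniz₂ δ (leibniz₂ δ x) = 0 := by
  refine tens_induction (L := leibniz₂ δ ∘ₗ leibniz₂ δ) (L' := 0) (fun p q => ?_) x
  simp [LinearMap.comp_apply, leibniz₂_tens, map_add, h, add_self_eq_zero_of_zmod_two]

lemma leibniz_sq (h : ∀ p, δ (δ p) = 0) (c : Chain (List (Cell₂ P))) :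
    leibniz δ (leibniz δ c) = 0 := by
  refine word_induction (L := leibniz δ ∘ₗ leibniz δ) (L' := 0)
    (by simp [leibniz_nil, -Finsupp.linearCombination_single]) (fun x c hc => ?_) c
  simp only [LinearMap.comp_apply, LinearMap.zero_apply] at hc ⊢
  simp [leibniz_cons, map_add, hc, leibniz₂_sq _ h, add_self_eq_zero_of_zmod_two]

/-- The relation between words that differ in a single cell, related by `R`. -/
def ReplaceOne (R : Cell P → Cell P → Prop) (w w' : List (Cell₂ P)) : Prop :=
  ∃ l₁ x x' l₂, w = l₁ ++ x :: l₂ ∧ w' = l₁ ++ x' :: l₂ ∧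
    ((R x.1 x'.1 ∧ x.2 = x'.2) ∨ (x.1 = x'.1 ∧ R x.2 x'.2))

variable {δ} in
lemma leibniz_mem {R : Cell P → Cell P → Prop}
    (h : ∀ p, δ (basic p) ∈ chainsIn {p' | R p p'}) (w : List (Cell₂ P)) :
    leibniz δ (basic w) ∈ chainsIn {w' | ReplaceOne R w w'} := by
  induction w with
  | nil => rw [leibniz_nil]; exact zero_mem _
  | cons x w ih =>
    have hx : leibniz₂ δ (basic x) ∈
        chainsIn {x' | (R x.1 x'.1 ∧ x.2 = x'.2) ∨ (x.1 = x'.1 ∧ R x.2 x'.2)} := by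
      rw [leibniz₂, extend_basic]
      refine add_mem (bilin_mem (S := {p' | R x.1 p'}) (S' := {x.2}) ?_ (h x.1) (basic_mem rfl))
        (bilin_mem (S := {x.1}) (S' := {p' | R x.2 p'}) ?_ (basic_mem rfl) (h x.2))
      · exact fun p hp q hq => Or.inl ⟨hp, hq.symm⟩
      · exact fun p hp q hq => Or.inr ⟨hp.symm, hq⟩
    rw [← bilin_basic List.cons x w, leibniz_cons]
    refine add_mem (bilin_mem (S' := {w}) ?_ hx (basic_mem rfl))
      (bilin_mem (S := {x}) ?_ (basic_mem rfl) ih)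
    · rintro x' hx' _ rfl
      exact ⟨[], x, x', _, rfl, rfl, hx'⟩
    · rintro _ rfl _ ⟨l₁, y, y', l₂, rfl, rfl, hy⟩
      exact ⟨_ :: l₁, y, y', l₂, rfl, rfl, hy⟩

/-- The dimension of a product of cells. -/
def wordDim (w : List (Cell₂ P)) : ℕ := (w.map fun x => x.1.dim + x.2.dim).sum

/-- The initial vertex of a product of cells. -/
def wordBot (w : List (Cell₂ P)) : List (P × P) := w.map fun x => (x.1.bot, x.2.bot)

/-- The vertices of a product of cells. -/
def box (w : List (Cell₂ P)) : Set (List (P × P)) :=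
  {z | List.Forall₂ (fun x y => y.1 ∈ x.1.ends ∧ y.2 ∈ x.2.ends) w z}

lemma wordBot_mem_box (w : List (Cell₂ P)) : wordBot w ∈ box w := by
  induction w with
  | nil => exact List.Forall₂.nil
  | cons x w ih => exact List.Forall₂.cons ⟨x.1.bot_mem_ends, x.2.bot_mem_ends⟩ ih

/-- The initial facets of a product of cells. -/
abbrev botFaces : Chain (List (Cell₂ P)) →ₗ[ZMod 2] Chain (List (Cell₂ P)) := leibniz botFace

/-- The terminal facets of a product of cells. -/
abbrev topFaces : Chain (List (Cell₂ P)) →ₗ[ZMod 2] Chain (List (Cell₂ P)) := leibniz topFace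

/-- The cubical boundary. -/
def boundary : Chain (List (Cell₂ P)) →ₗ[ZMod 2] Chain (List (Cell₂ P)) := botFaces + topFaces

lemma botFace_mem (p : Cell P) :
    botFace (basic p) ∈ chainsIn {p' | p'.dim + 1 = p.dim ∧ p'.bot = p.bot} := by
  rw [botFace, extend_basic]
  cases p with
  | pt u => exact zero_mem _
  | seg u w => exact basic_mem ⟨rfl, rfl⟩

lemma topFace_mem (p : Cell P) :
    topFace (basic p) ∈ chainsIn {p' | p'.dim + 1 = p.dim ∧ p'.ends ⊆ p.ends} := by
  rw [topFace, extend_basic]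
  cases p with
  | pt u => exact zero_mem _
  | seg u w => exact basic_mem ⟨rfl, by simp [Cell.ends]⟩

lemma ReplaceOne.wordDim {R : Cell P → Cell P → Prop} (hR : ∀ p p', R p p' → p'.dim + 1 = p.dim)
    {w w' : List (Cell₂ P)} (h : ReplaceOne R w w') : wordDim w' + 1 = wordDim w := by
  obtain ⟨l₁, x, x', l₂, rfl, rfl, ⟨h, h'⟩ | ⟨h', h⟩⟩ := h <;>
  · have := hR _ _ h
    simp only [K5Power.wordDim, List.map_append, List.map_cons, List.sum_append, List.sum_cons, h']
    omega

lemma botFaces_mem (w : List (Cell₂ P)) : botFaces (basic w) ∈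
    chainsIn {w' | wordDim w' + 1 = wordDim w ∧ wordBot w' = wordBot w} := by
  refine chainsIn_mono ?_ (leibniz_mem botFace_mem w)
  intro w' h
  rw [Set.mem_ofPred_eq] at h
  refine ⟨h.wordDim fun _ _ h => h.1, ?_⟩
  obtain ⟨l₁, x, x', l₂, rfl, rfl, ⟨h, h'⟩ | ⟨h', h⟩⟩ := h <;>
    simp [wordBot, h', h.2]

lemma topFaces_mem (w : List (Cell₂ P)) : topFaces (basic w) ∈
    chainsIn {w' | wordDim w' + 1 = wordDim w ∧ box w' ⊆ box w} := by
  refine chainsIn_mono ?_ (leibniz_mem topFace_mem w)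
  intro w' h
  rw [Set.mem_ofPred_eq] at h
  refine ⟨h.wordDim fun _ _ h => h.1, ?_⟩
  obtain ⟨l₁, x, x', l₂, rfl, rfl, hx⟩ := h
  intro z hz
  simp only [box, Set.mem_ofPred_eq] at hz ⊢
  rw [List.forall₂_iff_get] at hz ⊢
  refine ⟨by simpa using hz.1, fun i h₁ h₂ => ?_⟩
  have h₁' : i < (l₁ ++ x' :: l₂).length := by simpa using h₁
  have := hz.2 i h₁' h₂
  simp only [List.get_eq_getElem, List.getElem_append, List.getElem_cons] at this ⊢
  split_ifs at this ⊢ with h3 h4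
  · exact this
  · rcases hx with ⟨h, h'⟩ | ⟨h', h⟩
    · exact ⟨h.2 this.1, h' ▸ this.2⟩
    · exact ⟨h' ▸ this.1, h.2 this.2⟩
  · exact this

lemma botFace_topFace (p : Chain (Cell P)) : botFace (topFace p) = 0 := by
  suffices botFace ∘ₗ topFace = (0 : Chain (Cell P) →ₗ[ZMod 2] _) from LinearMap.congr_fun this p
  refine linearMap_ext_basic fun a => ?_
  cases a <;> simp [botFace, topFace]

lemma topFace_botFace (p : Chain (Cell P)) : topFace (botFace p) = 0 := by
  suffices topFace ∘ₗ botFace = (0 : Chain (Cell P) →ₗ[ZMod 2] _) from LinearMap.congr_fun this p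
  refine linearMap_ext_basic fun a => ?_
  cases a <;> simp [botFace, topFace]

lemma topFace_topFace (p : Chain (Cell P)) : topFace (topFace p) = 0 := by
  suffices topFace ∘ₗ topFace = (0 : Chain (Cell P) →ₗ[ZMod 2] _) from LinearMap.congr_fun this p
  refine linearMap_ext_basic fun a => ?_
  cases a <;> simp [topFace]

/-- The augmentation of chains of cells. -/
def aug₁ : Chain (Cell P) →ₗ[ZMod 2] ZMod 2 := extend fun p => if p.dim = 0 then 1 else 0

/-- The augmentation of chains of pairs of cells. -/
def aug₂ : Chain (Cell₂ P) →ₗ[ZMod 2] ZMod 2 :=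
  extend fun x => if x.1.dim + x.2.dim = 0 then 1 else 0

/-- The augmentation of chains of words. -/
def aug : Chain (List (Cell₂ P)) →ₗ[ZMod 2] ZMod 2 :=
  extend fun w => if wordDim w = 0 then 1 else 0

lemma aug₂_tens (p q : Chain (Cell P)) : aug₂ (tens p q) = aug₁ p * aug₁ q := by
  have : tens.compr₂ aug₂ = (LinearMap.mul (ZMod 2) (ZMod 2)).compl₁₂ (aug₁ (P := P)) aug₁ := by
    refine linearMap_ext_basic fun a => linearMap_ext_basic fun b => ?_
    simp only [LinearMap.compr₂_apply, LinearMap.compl₁₂_apply, LinearMap.mul_apply', bilin_basic,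
      aug₁, aug₂, extend_basic]
    by_cases h : a.dim = 0 <;> simp [h]
  exact LinearMap.congr_fun₂ this p q

lemma aug_cons (x : Chain (Cell₂ P)) (c : Chain (List (Cell₂ P))) :
    aug (cons x c) = aug₂ x * aug c := by
  have : cons.compr₂ aug = (LinearMap.mul (ZMod 2) (ZMod 2)).compl₁₂ (aug₂ (P := P)) aug := by
    refine linearMap_ext_basic fun a => linearMap_ext_basic fun b => ?_
    simp only [LinearMap.compr₂_apply, LinearMap.compl₁₂_apply, LinearMap.mul_apply', bilin_basic,
      aug, aug₂, extend_basic]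
    rw [show wordDim (a :: b) = a.1.dim + a.2.dim + wordDim b from rfl]
    generalize a.1.dim + a.2.dim = m
    generalize wordDim b = k
    cases m <;> cases k <;> simp
  exact LinearMap.congr_fun₂ this x c

lemma aug_botFaces (c : Chain (List (Cell₂ P))) : aug (botFaces c) = aug (topFaces c) := by
  have h1 : ∀ p : Chain (Cell P), aug₁ (botFace p) = aug₁ (topFace p) := fun p => by
    suffices aug₁ ∘ₗ botFace = aug₁ ∘ₗ topFace (P := P) from LinearMap.congr_fun this p
    refine linearMap_ext_basic fun a => ?_
    cases a <;> simp [botFace, topFace, aug₁, Cell.dim]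
  have h2 : ∀ x : Chain (Cell₂ P), aug₂ (leibniz₂ botFace x) = aug₂ (leibniz₂ topFace x) := by
    intro x
    suffices aug₂ ∘ₗ leibniz₂ botFace = aug₂ ∘ₗ leibniz₂ topFace (P := P) from
      LinearMap.congr_fun this x
    refine linearMap_ext_basic fun a => ?_
    rw [LinearMap.comp_apply, LinearMap.comp_apply, ← bilin_basic Prod.mk a.1 a.2, leibniz₂_tens,
      leibniz₂_tens]
    simp only [map_add, aug₂_tens, h1]
  refine word_induction (L := aug ∘ₗ botFaces) (L' := aug ∘ₗ topFaces)
    (by simp [leibniz_nil, -Finsupp.linearCombination_single]) (fun x c hc => ?_) c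
  simp only [LinearMap.comp_apply] at hc ⊢
  simp only [leibniz_cons, map_add, hc, aug_cons, h2]

end Words

/-! ### The canonical triangulation of products of cells -/

section Triangulation

variable {P : Type*} (lab : List (P × P) → ℤ)

/-- The canonical triangulation of a `k`-dimensional product of cells, with vertices recorded by
their labels: a sum over all monotone edge paths from the initial to the terminal vertex. -/
def triangulateDim : ℕ → Chain (List (Cell₂ P)) →ₗ[ZMod 2] MvPolynomial ℤ (ZMod 2)
  | 0 => extend fun w => X (lab (wordBot w))
  | k + 1 => extend fun w => X (lab (wordBot w)) * triangulateDim k (topFaces (basic w))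

/-- The canonical triangulation of products of cells. -/
def triangulate : Chain (List (Cell₂ P)) →ₗ[ZMod 2] MvPolynomial ℤ (ZMod 2) :=
  extend fun w => triangulateDim lab (wordDim w) (basic w)

variable {lab}

lemma triangulateDim_zero_basic (w : List (Cell₂ P)) :
    triangulateDim lab 0 (basic w) = X (lab (wordBot w)) := by
  rw [triangulateDim, extend_basic]

lemma triangulateDim_succ_basic (k : ℕ) (w : List (Cell₂ P)) :
    triangulateDim lab (k + 1) (basic w) =
      X (lab (wordBot w)) * triangulateDim lab k (topFaces (basic w)) := by
  rw [triangulateDim, extend_basic]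

lemma triangulate_of_mem {k : ℕ} {c : Chain (List (Cell₂ P))}
    (hc : c ∈ chainsIn {w | wordDim w = k}) : triangulate lab c = triangulateDim lab k c := by
  refine eq_of_forall_basic _ _ (fun w hw => ?_) hc
  rw [triangulate, extend_basic, show wordDim w = k from hw]

lemma bdry_triangulateDim_zero {c : Chain (List (Cell₂ P))}
    (hc : c ∈ chainsIn {w | wordDim w = 0}) :
    bdry (triangulateDim lab 0 c) = aug c • 1 := by
  refine eq_of_forall_basic (bdry.toLinearMap ∘ₗ triangulateDim lab 0)
    ((LinearMap.toSpanSingleton (ZMod 2) (MvPolynomial ℤ (ZMod 2)) 1) ∘ₗ aug) (fun w hw => ?_) hc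
  have hw : wordDim w = 0 := hw
  rw [LinearMap.comp_apply, LinearMap.comp_apply, triangulateDim_zero_basic, aug, extend_basic,
    if_pos hw, LinearMap.toSpanSingleton_apply, one_smul]
  exact mkDerivation_X _ _ _

lemma triangulateDim_zero_of_bot {b : List (P × P)} {c : Chain (List (Cell₂ P))}
    (hc : c ∈ chainsIn {w | wordDim w = 0 ∧ wordBot w = b}) :
    triangulateDim lab 0 c = aug c • X (lab b) := by
  refine eq_of_forall_basic (triangulateDim lab 0)
    ((LinearMap.toSpanSingleton (ZMod 2) (MvPolynomial ℤ (ZMod 2)) (X (lab b))) ∘ₗ aug)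
    (fun w hw => ?_) hc
  rw [LinearMap.comp_apply, triangulateDim_zero_basic, aug, extend_basic,
    if_pos hw.1, LinearMap.toSpanSingleton_apply, one_smul, hw.2]

lemma triangulateDim_succ_of_bot {b : List (P × P)} {c : Chain (List (Cell₂ P))} (k : ℕ)
    (hc : c ∈ chainsIn {w | wordBot w = b}) :
    triangulateDim lab (k + 1) c = X (lab b) * triangulateDim lab k (topFaces c) := by
  refine eq_of_forall_basic (triangulateDim lab (k + 1))
    (LinearMap.mulLeft (ZMod 2) (X (lab b)) ∘ₗ triangulateDim lab k ∘ₗ topFaces)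
    (fun w hw => ?_) hc
  have hw : wordBot w = b := hw
  rw [LinearMap.comp_apply, LinearMap.comp_apply, triangulateDim_succ_basic, hw]
  rfl

lemma bdry_triangulateDim_succ (k : ℕ) {c : Chain (List (Cell₂ P))}
    (hc : c ∈ chainsIn {w | wordDim w = k + 1}) :
    bdry (triangulateDim lab (k + 1) c) = triangulateDim lab k (boundary c) := by
  induction k generalizing c with
  | zero =>
    refine eq_of_forall_basic (bdry.toLinearMap ∘ₗ triangulateDim lab 1)
      (triangulateDim lab 0 ∘ₗ boundary) (fun w hw => ?_) hc
    have hw : wordDim w = 1 := hw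
    have ht : topFaces (basic w) ∈ chainsIn {w | wordDim w = 0} :=
      chainsIn_mono (fun w' h => by have := h.1; simp only [Set.mem_ofPred_eq]; omega)
        (topFaces_mem w)
    have hs : botFaces (basic w) ∈ chainsIn {w' | wordDim w' = 0 ∧ wordBot w' = wordBot w} :=
      chainsIn_mono (fun w' h => by have := h.1; exact ⟨by omega, h.2⟩) (botFaces_mem w)
    change bdry (triangulateDim lab (0 + 1) (basic w)) = _
    rw [triangulateDim_succ_basic, bdry_X_mul, bdry_triangulateDim_zero ht, LinearMap.comp_apply,
      boundary, LinearMap.add_apply, map_add, triangulateDim_zero_of_bot hs, aug_botFaces,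
      mul_smul_comm, mul_one, add_comm]
  | succ k ih =>
    refine eq_of_forall_basic (bdry.toLinearMap ∘ₗ triangulateDim lab (k + 2))
      (triangulateDim lab (k + 1) ∘ₗ boundary) (fun w hw => ?_) hc
    have hw : wordDim w = k + 1 + 1 := hw
    have ht : topFaces (basic w) ∈ chainsIn {w | wordDim w = k + 1} :=
      chainsIn_mono (fun w' h => by have := h.1; simp only [Set.mem_ofPred_eq]; omega)
        (topFaces_mem w)
    have hs : botFaces (basic w) ∈ chainsIn {w' | wordBot w' = wordBot w} :=
      chainsIn_mono (fun w' h => h.2) (botFaces_mem w)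
    change bdry (triangulateDim lab (k + 1 + 1) (basic w)) = _
    rw [triangulateDim_succ_basic, bdry_X_mul, ih ht, LinearMap.comp_apply,
      boundary, LinearMap.add_apply, LinearMap.add_apply, map_add, map_add,
      triangulateDim_succ_of_bot k hs, leibniz_sq _ topFace_topFace, map_zero, add_zero,
      leibniz_comm botFace topFace (fun p => by rw [botFace_topFace, topFace_botFace]), add_comm]

lemma boundary_mem {w : List (Cell₂ P)} {k : ℕ} (hw : wordDim w = k + 1) :
    boundary (basic w) ∈ chainsIn {w | wordDim w = k} := by
  rw [boundary, LinearMap.add_apply]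
  exact add_mem
    (chainsIn_mono (fun w' h => by have := h.1; simp only [Set.mem_ofPred_eq]; omega)
      (botFaces_mem w))
    (chainsIn_mono (fun w' h => by have := h.1; simp only [Set.mem_ofPred_eq]; omega)
      (topFaces_mem w))

lemma boundary_of_wordDim_eq_zero {w : List (Cell₂ P)} (hw : wordDim w = 0) :
    boundary (basic w) = 0 := by
  have : boundary (basic w) ∈ chainsIn (∅ : Set (List (Cell₂ P))) := by
    rw [boundary, LinearMap.add_apply]
    exact add_mem
      (chainsIn_mono (fun w' h => by have := h.1; omega) (botFaces_mem w))
      (chainsIn_mono (fun w' h => by have := h.1; omega) (topFaces_mem w))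
  simpa using this

lemma bdry_triangulate (w : List (Cell₂ P)) :
    bdry (triangulate lab (basic w)) = triangulate lab (boundary (basic w)) + aug (basic w) • 1 := by
  rcases hk : wordDim w with _ | k
  · rw [boundary_of_wordDim_eq_zero hk, map_zero, zero_add,
      triangulate_of_mem (basic_mem (show w ∈ {w | wordDim w = 0} from hk)),
      bdry_triangulateDim_zero (basic_mem (show w ∈ {w | wordDim w = 0} from hk))]
  · rw [triangulate_of_mem (basic_mem (show w ∈ {w | wordDim w = k + 1} from hk)),
      bdry_triangulateDim_succ k (basic_mem (show w ∈ {w | wordDim w = k + 1} from hk)),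
      triangulate_of_mem (boundary_mem hk), aug, extend_basic, if_neg (by omega), zero_smul,
      add_zero]

lemma triangulateDim_mem (k : ℕ) (w : List (Cell₂ P)) :
    triangulateDim lab k (basic w) ∈ Submodule.span (ZMod 2)
      (simplex '' {l | l.length = k + 1 ∧ ∀ x ∈ l, ∃ z ∈ box w, lab z = x}) := by
  induction k generalizing w with
  | zero =>
    rw [triangulateDim_zero_basic]
    refine Submodule.subset_span ⟨[lab (wordBot w)], ⟨rfl, ?_⟩, by simp [simplex]⟩
    simp only [List.mem_singleton, forall_eq]
    exact ⟨_, wordBot_mem_box w, rfl⟩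
  | succ k ih =>
    rw [triangulateDim_succ_basic]
    have h1 : triangulateDim lab k (topFaces (basic w)) ∈ Submodule.span (ZMod 2)
        (simplex '' {l | l.length = k + 1 ∧ ∀ x ∈ l, ∃ z ∈ box w, lab z = x}) := by
      refine map_mem_of_forall_basic _ _ (fun w' hw' => ?_) (topFaces_mem w)
      refine Submodule.span_mono (Set.image_mono ?_) (ih w')
      rintro l ⟨hl, h⟩
      refine ⟨hl, fun x hx => ?_⟩
      obtain ⟨z, hz, rfl⟩ := h x hx
      exact ⟨z, hw'.2 hz, rfl⟩
    have h2 : Submodule.span (ZMod 2)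
        (simplex '' {l | l.length = k + 1 ∧ ∀ x ∈ l, ∃ z ∈ box w, lab z = x}) ≤
        (Submodule.span (ZMod 2) (simplex ''
          {l | l.length = k + 1 + 1 ∧ ∀ x ∈ l, ∃ z ∈ box w, lab z = x})).comap
          (LinearMap.mulLeft (ZMod 2) (X (lab (wordBot w)))) := by
      rw [Submodule.span_le]
      rintro _ ⟨l, ⟨hl, h⟩, rfl⟩
      refine Submodule.subset_span ⟨lab (wordBot w) :: l, ⟨by simp [hl], ?_⟩, by simp [simplex]⟩
      simp only [List.mem_cons, forall_eq_or_imp]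
      exact ⟨⟨_, wordBot_mem_box w, rfl⟩, h⟩
    exact h2 h1

lemma triangulate_mem (w : List (Cell₂ P)) :
    triangulate lab (basic w) ∈ Submodule.span (ZMod 2)
      (simplex '' {l | l.length = wordDim w + 1 ∧ ∀ x ∈ l, ∃ z ∈ box w, lab z = x}) := by
  rw [triangulate, extend_basic]
  exact triangulateDim_mem _ w

/-- The interchange of factors on pairs of cells. -/
def swap₂ : Chain (Cell₂ P) →ₗ[ZMod 2] Chain (Cell₂ P) :=
  Finsupp.lmapDomain (ZMod 2) (ZMod 2) Prod.swap

/-- The interchange of factors on words. -/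
def swapWord : Chain (List (Cell₂ P)) →ₗ[ZMod 2] Chain (List (Cell₂ P)) :=
  Finsupp.lmapDomain (ZMod 2) (ZMod 2) (List.map Prod.swap)

lemma swapWord_basic (w : List (Cell₂ P)) :
    swapWord (basic w) = basic (w.map Prod.swap) := by
  simp [swapWord]

lemma swap₂_basic (x : Cell₂ P) : swap₂ (basic x) = basic x.swap := by
  simp [swap₂]

lemma swap₂_tens (p q : Chain (Cell P)) : swap₂ (tens p q) = tens q p := by
  have : tens.compr₂ swap₂ = tens.flip (R := ZMod 2) (M := Chain (Cell P)) := by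
    refine linearMap_ext_basic fun a => linearMap_ext_basic fun b => ?_
    simp only [LinearMap.compr₂_apply, LinearMap.flip_apply, bilin_basic, swap₂_basic]
    rfl
  exact LinearMap.congr_fun₂ this p q

lemma swapWord_cons (x : Chain (Cell₂ P)) (c : Chain (List (Cell₂ P))) :
    swapWord (cons x c) = cons (swap₂ x) (swapWord c) := by
  have : cons.compr₂ swapWord = cons.compl₁₂ swap₂ (swapWord (P := P)) := by
    refine linearMap_ext_basic fun a => linearMap_ext_basic fun b => ?_
    simp only [LinearMap.compr₂_apply, LinearMap.compl₁₂_apply, bilin_basic, swap₂_basic,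
      swapWord_basic]
    rfl
  exact LinearMap.congr_fun₂ this x c

lemma swapWord_swapWord (c : Chain (List (Cell₂ P))) : swapWord (swapWord c) = c := by
  suffices swapWord ∘ₗ swapWord = LinearMap.id (R := ZMod 2) (M := Chain (List (Cell₂ P))) from
    LinearMap.congr_fun this c
  refine linearMap_ext_basic fun w => ?_
  simp [swapWord_basic]

lemma leibniz_swapWord (δ : Chain (Cell P) →ₗ[ZMod 2] Chain (Cell P))
    (c : Chain (List (Cell₂ P))) : leibniz δ (swapWord c) = swapWord (leibniz δ c) := by
  have h2 : ∀ x : Chain (Cell₂ P), leibniz₂ δ (swap₂ x) = swap₂ (leibniz₂ δ x) := fun x => by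
    refine tens_induction (L := leibniz₂ δ ∘ₗ swap₂) (L' := swap₂ ∘ₗ leibniz₂ δ)
      (fun p q => ?_) x
    simp only [LinearMap.comp_apply, swap₂_tens, leibniz₂_tens, map_add]
    abel
  refine word_induction (L := leibniz δ ∘ₗ swapWord) (L' := swapWord ∘ₗ leibniz δ)
    ?_ (fun x c hc => ?_) c
  · simp [swapWord_basic, leibniz_nil, -Finsupp.linearCombination_single]
  · simp only [LinearMap.comp_apply] at hc ⊢
    simp only [leibniz_cons, swapWord_cons, map_add, hc, h2]

lemma wordDim_map_swap (w : List (Cell₂ P)) : wordDim (w.map Prod.swap) = wordDim w := by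
  simp only [wordDim, List.map_map]
  congr 1
  refine List.map_congr_left fun x _ => ?_
  simp [add_comm]

lemma wordBot_map_swap (w : List (Cell₂ P)) :
    wordBot (w.map Prod.swap) = (wordBot w).map Prod.swap := by
  simp [wordBot]

lemma triangulateDim_swapWord (hlab : ∀ z, lab (z.map Prod.swap) = -lab z) (k : ℕ)
    (c : Chain (List (Cell₂ P))) :
    triangulateDim lab k (swapWord c) = rename Neg.neg (triangulateDim lab k c) := by
  induction k generalizing c with
  | zero =>
    suffices triangulateDim lab 0 ∘ₗ swapWord =
      (rename (R := ZMod 2) Neg.neg).toLinearMap ∘ₗ triangulateDim lab 0 from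
      LinearMap.congr_fun this c
    refine linearMap_ext_basic fun w => ?_
    simp only [LinearMap.comp_apply, swapWord_basic, triangulateDim_zero_basic, wordBot_map_swap,
      hlab, AlgHom.toLinearMap_apply, rename_X]
  | succ k ih =>
    suffices triangulateDim lab (k + 1) ∘ₗ swapWord =
      (rename (R := ZMod 2) Neg.neg).toLinearMap ∘ₗ triangulateDim lab (k + 1) from
      LinearMap.congr_fun this c
    refine linearMap_ext_basic fun w => ?_
    simp only [LinearMap.comp_apply, swapWord_basic, triangulateDim_succ_basic, wordBot_map_swap,
      hlab, AlgHom.toLinearMap_apply, map_mul, rename_X]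
    rw [← swapWord_basic, leibniz_swapWord, ih]

lemma triangulate_swapWord (hlab : ∀ z, lab (z.map Prod.swap) = -lab z) (w : List (Cell₂ P)) :
    triangulate lab (swapWord (basic w)) = rename Neg.neg (triangulate lab (basic w)) := by
  rw [swapWord_basic, triangulate, extend_basic, extend_basic, wordDim_map_swap, ← swapWord_basic,
    triangulateDim_swapWord hlab]

lemma fan_boundary {S : Set (List (Cell₂ P))} (hlab : ∀ z, lab (z.map Prod.swap) = -lab z)
    (hS : ∀ w ∈ S, ∀ z ∈ box w, ∀ z' ∈ box w, lab z + lab z' ≠ 0)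
    {c : Chain (List (Cell₂ P))} (hc : c ∈ chainsIn S) :
    fan (triangulate lab (boundary c)) + aug c =
      fan (triangulate lab c) + fan (triangulate lab (swapWord c)) := by
  refine eq_of_forall_basic (fan ∘ₗ triangulate lab ∘ₗ boundary + aug)
    (fan ∘ₗ triangulate lab + fan ∘ₗ triangulate lab ∘ₗ swapWord) (fun w hw => ?_) hc
  simp only [LinearMap.add_apply, LinearMap.comp_apply]
  have h1 : fan (1 : MvPolynomial ℤ (ZMod 2)) = 1 := by
    have : (1 : MvPolynomial ℤ (ZMod 2)) = simplex [] := by simp [simplex]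
    rw [this, fan_simplex_of_sorted (by simp [NoOpposite]) (by simp)]
    rfl
  have h2 := congrArg fan (bdry_triangulate (lab := lab) w)
  rw [map_add, map_smul, h1, smul_eq_mul, mul_one] at h2
  rw [← h2, triangulate_swapWord hlab]
  have h3 : Submodule.span (ZMod 2)
      (simplex '' {l | l.length = wordDim w + 1 ∧ ∀ x ∈ l, ∃ z ∈ box w, lab z = x}) ≤
      LinearMap.eqLocus (fan ∘ₗ bdry.toLinearMap)
        (fan + fan ∘ₗ (rename (R := ZMod 2) Neg.neg).toLinearMap) := by
    rw [Submodule.span_le]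
    rintro _ ⟨l, ⟨-, hl⟩, rfl⟩
    refine fan_bdry_simplex fun x hx y hy => ?_
    obtain ⟨z, hz, rfl⟩ := hl x hx
    obtain ⟨z', hz', rfl⟩ := hl y hy
    exact hS w hw z hz z' hz'
  exact h3 (triangulate_mem w)

lemma fan_triangulate_eq_zero {n : ℕ} {S : Set (List (Cell₂ P))}
    (hn : ∀ z, (lab z).natAbs ≤ n)
    (hS : ∀ w ∈ S, ∀ z ∈ box w, ∀ z' ∈ box w, lab z + lab z' ≠ 0)
    {c : Chain (List (Cell₂ P))} (hc : c ∈ chainsIn (S ∩ {w | wordDim w = n})) :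
    fan (triangulate lab c) = 0 := by
  refine eq_of_forall_basic (fan ∘ₗ triangulate lab) 0 (fun w hw => ?_) hc
  have h3 : Submodule.span (ZMod 2)
      (simplex '' {l | l.length = wordDim w + 1 ∧ ∀ x ∈ l, ∃ z ∈ box w, lab z = x}) ≤
      LinearMap.ker fan := by
    rw [Submodule.span_le]
    rintro _ ⟨l, ⟨hl', hl⟩, rfl⟩
    refine fan_simplex_eq_zero (n := n) (fun x hx y hy => ?_) (fun x hx => ?_) ?_
    · obtain ⟨z, hz, rfl⟩ := hl x hx
      obtain ⟨z', hz', rfl⟩ := hl y hy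
      exact hS w hw.1 z hz z' hz'
    · obtain ⟨z, hz, rfl⟩ := hl x hx
      exact hn z
    · have : wordDim w = n := hw.2
      omega
  exact h3 (triangulate_mem w)

end Triangulation

/-! ### The equivariant chain in the deleted square -/

section Recursion

variable {P : Type*}

/-- The boundary of a chain of cells. -/
def boundary₁ : Chain (Cell P) →ₗ[ZMod 2] Chain (Cell P) := botFace + topFace

/-- The boundary of a chain of products of two cells. -/
def boundary₂ : Chain (Cell₂ P) →ₗ[ZMod 2] Chain (Cell₂ P) := leibniz₂ botFace + leibniz₂ topFace

lemma boundary₂_tens (p q : Chain (Cell P)) :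
    boundary₂ (tens p q) = tens (boundary₁ p) q + tens p (boundary₁ q) := by
  simp only [boundary₁, boundary₂, LinearMap.add_apply, leibniz₂_tens, map_add]
  abel

lemma boundary_cons (x : Chain (Cell₂ P)) (c : Chain (List (Cell₂ P))) :
    boundary (cons x c) = cons (boundary₂ x) c + cons x (boundary c) := by
  simp only [boundary, boundary₂, LinearMap.add_apply, leibniz_cons, map_add]
  abel

lemma boundary_nil : boundary (basic ([] : List (Cell₂ P))) = 0 := by
  simp [boundary, leibniz_nil, -Finsupp.linearCombination_single]

lemma boundary_swapWord (c : Chain (List (Cell₂ P))) :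
    boundary (swapWord c) = swapWord (boundary c) := by
  simp only [boundary, LinearMap.add_apply, map_add, leibniz_swapWord]

lemma aug_eq_zero {n : ℕ} (hn : n ≠ 0) {c : Chain (List (Cell₂ P))}
    (hc : c ∈ chainsIn {w | wordDim w = n}) : aug c = 0 := by
  refine eq_of_forall_basic aug 0 (fun w hw => ?_) hc
  rw [aug, extend_basic, if_neg (by rw [show wordDim w = n from hw]; exact hn)]
  rfl

/-- The words of length `n` in letters of `T`. -/
def wordsOf (T : Set (Cell₂ P)) (n : ℕ) : Set (List (Cell₂ P)) :=
  {w | w.length = n ∧ ∀ p ∈ w, p ∈ T}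

/-- The words of length `n` in letters of `T`, with at least one letter in `U`. -/
def wordsMeeting (T U : Set (Cell₂ P)) (n : ℕ) : Set (List (Cell₂ P)) :=
  {w | w ∈ wordsOf T n ∧ ∃ p ∈ w, p ∈ U}

/-- The words of total dimension `n`. -/
def wordsDim (n : ℕ) : Set (List (Cell₂ P)) := {w | wordDim w = n}

lemma cons_wordsOf {T : Set (Cell₂ P)} {n : ℕ} {p : Cell₂ P} (hp : p ∈ T)
    {w : List (Cell₂ P)} (hw : w ∈ wordsOf T n) : p :: w ∈ wordsOf T (n + 1) :=
  ⟨by simp [hw.1], List.forall_mem_cons.2 ⟨hp, hw.2⟩⟩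

lemma cons_wordsMeeting_left {T U : Set (Cell₂ P)} {n : ℕ} {p : Cell₂ P} (hp : p ∈ T ∩ U)
    {w : List (Cell₂ P)} (hw : w ∈ wordsOf T n) : p :: w ∈ wordsMeeting T U (n + 1) :=
  ⟨cons_wordsOf hp.1 hw, p, by simp, hp.2⟩

lemma cons_wordsMeeting_right {T U : Set (Cell₂ P)} {n : ℕ} {p : Cell₂ P} (hp : p ∈ T)
    {w : List (Cell₂ P)} (hw : w ∈ wordsMeeting T U n) : p :: w ∈ wordsMeeting T U (n + 1) :=
  ⟨cons_wordsOf hp hw.1, hw.2.imp fun _ h => ⟨List.mem_cons_of_mem _ h.1, h.2⟩⟩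

lemma cons_wordsDim {n k m : ℕ} {p : Cell₂ P} (hp : p.1.dim + p.2.dim = k)
    {w : List (Cell₂ P)} (hw : w ∈ wordsDim n) (hm : k + n = m) : p :: w ∈ wordsDim m := by
  have hw : wordDim w = n := hw
  show p.1.dim + p.2.dim + wordDim w = m
  rw [hp, hw, hm]

lemma swapWord_mem {S S' : Set (List (Cell₂ P))} (h : ∀ w ∈ S, w.map Prod.swap ∈ S')
    {c : Chain (List (Cell₂ P))} (hc : c ∈ chainsIn S) : swapWord c ∈ chainsIn S' :=
  map_mem_of_forall_basic _ _ (fun w hw => by rw [swapWord_basic]; exact basic_mem (h w hw)) hc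

lemma map_swap_wordsOf {T : Set (Cell₂ P)} (hT : ∀ p ∈ T, p.swap ∈ T) {n : ℕ}
    {w : List (Cell₂ P)} (hw : w ∈ wordsOf T n) : w.map Prod.swap ∈ wordsOf T n := by
  refine ⟨by simp [hw.1], fun p hp => ?_⟩
  obtain ⟨q, hq, rfl⟩ := List.mem_map.1 hp
  exact hT q (hw.2 q hq)

lemma map_swap_wordsMeeting {T U : Set (Cell₂ P)} (hT : ∀ p ∈ T, p.swap ∈ T)
    (hU : ∀ p ∈ U, p.swap ∈ U) {n : ℕ}
    {w : List (Cell₂ P)} (hw : w ∈ wordsMeeting T U n) :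
    w.map Prod.swap ∈ wordsMeeting T U n := by
  obtain ⟨hw, p, hp, hpU⟩ := hw
  exact ⟨map_swap_wordsOf hT hw, p.swap, List.mem_map_of_mem hp, hU p hpU⟩

/-- Equivariant chains on the square of a graph that witness the nonvanishing of the
Van Kampen obstruction: up to the chain `B` they are supported off the diagonal. -/
structure Obstruction (T U : Set (Cell₂ P)) (B H₁ H₀ Z : Chain (Cell₂ P)) : Prop where
  boundary_B : boundary₂ B = H₁ + swap₂ H₁
  boundary_H₁ : boundary₂ H₁ = H₀ + swap₂ H₀
  boundary_H₀ : boundary₂ H₀ = 0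
  boundary_Z : boundary₂ Z = 0
  swap_B : swap₂ B = B
  aug_B : aug₂ B = 0
  aug_H₁ : aug₂ H₁ = 0
  aug_H₀ : aug₂ H₀ = 1
  mem_B : B ∈ chainsIn (T ∩ {p | p.1.dim + p.2.dim = 2})
  mem_H₁ : H₁ ∈ chainsIn (T ∩ U)
  mem_H₀ : H₀ ∈ chainsIn (T ∩ U)
  mem_ZB : Z + B ∈ chainsIn (T ∩ U ∩ {p | p.1.dim + p.2.dim = 2})
  swap_T : ∀ p ∈ T, p.swap ∈ T
  swap_U : ∀ p ∈ U, p.swap ∈ U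

variable {T U : Set (Cell₂ P)} {B H₁ H₀ Z : Chain (Cell₂ P)}

lemma Obstruction.exists_power (h : Obstruction T U B H₁ H₀ Z) (n : ℕ) :
    ∃ b x D : Chain (List (Cell₂ P)),
      boundary (b + x) = b + x + swapWord (b + x) ∧ boundary (b + D) = 0 ∧ swapWord b = b ∧
      aug (b + x) = 1 ∧ b ∈ chainsIn (wordsOf T n ∩ wordsDim (2 * n)) ∧
      x ∈ chainsIn (wordsMeeting T U n) ∧
      D ∈ chainsIn (wordsMeeting T U n ∩ wordsDim (2 * n)) := by
  induction n with
  | zero =>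
    refine ⟨basic [], 0, 0, ?_, ?_, ?_, ?_, basic_mem (a := []) ?_, zero_mem _, zero_mem _⟩
    · rw [add_zero, boundary_nil, swapWord_basic, List.map_nil, add_self_eq_zero_of_zmod_two]
    · rw [add_zero, boundary_nil]
    · rw [swapWord_basic, List.map_nil]
    · simp [aug, wordDim]
    · exact ⟨⟨rfl, by simp⟩, rfl⟩
  | succ n ih =>
    obtain ⟨b, x, D, hbx, hbD, hb, haug, hbm, hxm, hDm⟩ := ih
    have hbx' : b + x ∈ chainsIn (wordsOf T n) :=
      add_mem (chainsIn_mono Set.inter_subset_left hbm) (chainsIn_mono (fun w hw => hw.1) hxm)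
    have hbD' : b + D ∈ chainsIn (wordsOf T n ∩ wordsDim (2 * n)) :=
      add_mem hbm (chainsIn_mono (by exact fun w hw => ⟨hw.1.1, hw.2⟩) hDm)
    have hB : B ∈ chainsIn T := chainsIn_mono Set.inter_subset_left h.mem_B
    refine ⟨cons B b, cons B x + cons H₁ (swapWord (b + x)) + cons H₀ (b + x),
      cons (Z + B) (b + D) + cons B D, ?_, ?_, ?_, ?_, ?_, ?_, ?_⟩
    · have e : cons B b + (cons B x + cons H₁ (swapWord (b + x)) + cons H₀ (b + x)) =
        cons B (b + x) + cons H₁ (swapWord (b + x)) + cons H₀ (b + x) := by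
        rw [map_add (cons B)]; abel
      rw [e]
      generalize b + x = c at *
      simp only [map_add, boundary_cons, boundary_swapWord, hbx, h.boundary_B, h.boundary_H₁,
        h.boundary_H₀, swapWord_cons, h.swap_B, swapWord_swapWord, LinearMap.add_apply, map_zero,
        LinearMap.zero_apply]
      have h1 := add_self_eq_zero_of_zmod_two (cons H₁ c)
      have h2 := add_self_eq_zero_of_zmod_two (cons H₀ (swapWord c))
      linear_combination (norm := abel) h1 + h2
    · have e : cons B b + (cons (Z + B) (b + D) + cons B D) = cons Z (b + D) := by
        have h1 := add_self_eq_zero_of_zmod_two (cons B b)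
        have h2 := add_self_eq_zero_of_zmod_two (cons B D)
        simp only [map_add, LinearMap.add_apply]
        linear_combination (norm := abel) h1 + h2
      rw [e, boundary_cons, h.boundary_Z, hbD, map_zero, map_zero, LinearMap.zero_apply, add_zero]
    · rw [swapWord_cons, h.swap_B, hb]
    · simp only [map_add, aug_cons, h.aug_B, h.aug_H₁, h.aug_H₀] at haug ⊢
      simpa using haug
    · exact bilin_mem (by exact fun p hp w hw => ⟨cons_wordsOf hp.1 hw.1,
        cons_wordsDim hp.2 hw.2 (by ring)⟩) h.mem_B hbm
    · refine add_mem (add_mem ?_ ?_) ?_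
      · exact bilin_mem (fun p hp w hw => cons_wordsMeeting_right hp hw) hB hxm
      · exact bilin_mem (fun p hp w hw => cons_wordsMeeting_left hp hw) h.mem_H₁
          (swapWord_mem (fun w => map_swap_wordsOf h.swap_T) hbx')
      · exact bilin_mem (fun p hp w hw => cons_wordsMeeting_left hp hw) h.mem_H₀ hbx'
    · refine add_mem ?_ ?_
      · exact bilin_mem (by exact fun p hp w hw => ⟨cons_wordsMeeting_left hp.1 hw.1,
          cons_wordsDim hp.2 hw.2 (by ring)⟩) h.mem_ZB hbD'
      · exact bilin_mem (by exact fun p hp w hw => ⟨cons_wordsMeeting_right hp.1 hw.1,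
          cons_wordsDim hp.2 hw.2 (by ring)⟩) h.mem_B hDm

/-- There is no odd labelling of the vertices by `±1, …, ±2n` without opposite labels on the
off-diagonal products of cells. -/
theorem Obstruction.not_labelling (h : Obstruction T U B H₁ H₀ Z) {n : ℕ} (hn : 0 < n)
    {lab : List (P × P) → ℤ} (hlab : ∀ z, lab (z.map Prod.swap) = -lab z)
    (hle : ∀ z, (lab z).natAbs ≤ 2 * n) :
    ¬ ∀ w ∈ wordsMeeting T U n, ∀ z ∈ box w, ∀ z' ∈ box w, lab z + lab z' ≠ 0 := by
  intro hS
  obtain ⟨b, x, D, hbx, hbD, hb, haug, hbm, hxm, hDm⟩ := h.exists_power n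
  have hbdry : boundary (x + D) = x + swapWord x := by
    have h1 := add_self_eq_zero_of_zmod_two (boundary b)
    have h2 := add_self_eq_zero_of_zmod_two b
    simp only [map_add, hb] at hbx hbD ⊢
    linear_combination (norm := abel) hbx + hbD - h1 + h2
  have hD : D ∈ chainsIn (wordsMeeting T U n) := chainsIn_mono Set.inter_subset_left hDm
  have hsD : swapWord D ∈ chainsIn (wordsMeeting T U n ∩ wordsDim (2 * n)) :=
    swapWord_mem (by exact fun w hw => ⟨map_swap_wordsMeeting h.swap_T h.swap_U hw.1,
      (wordDim_map_swap w).trans hw.2⟩) hDm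
  have key := fan_boundary hlab hS (add_mem hxm hD)
  have hDfan := fan_triangulate_eq_zero hle hS hDm
  have hsDfan := fan_triangulate_eq_zero hle hS hsD
  have hbaug : aug b = 0 :=
    aug_eq_zero (n := 2 * n) (by omega) (chainsIn_mono Set.inter_subset_right hbm)
  have hDaug : aug D = 0 :=
    aug_eq_zero (n := 2 * n) (by omega) (chainsIn_mono Set.inter_subset_right hDm)
  rw [map_add, hbaug, zero_add] at haug
  rw [hbdry] at key
  simp only [map_add, hDfan, hsDfan, hDaug, haug, add_zero] at key
  exact one_ne_zero (add_eq_left.1 key)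

end Recursion

/-! ### The obstruction of the complete graph on five vertices -/

section CompleteGraph

variable {P : Type*}

lemma eq_of_one_smul {M : Type*} [AddCommGroup M] [Module (ZMod 2) M] {x y : M}
    (h : (1 : ZMod 2) • x = y) : x = y := by
  rwa [one_smul] at h

/-- The sum of the products of distinct chains among three. -/
def offDiagonal (p q : Fin 3 → Chain (Cell P)) : Chain (Cell₂ P) :=
  tens (p 0) (q 1) + tens (p 1) (q 0) + tens (p 0) (q 2) + tens (p 2) (q 0) +
    tens (p 1) (q 2) + tens (p 2) (q 1)

/-- The sum of the ordered products of distinct chains among three. -/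
def upperDiagonal (p q : Fin 3 → Chain (Cell P)) : Chain (Cell₂ P) :=
  tens (p 0) (q 1) + tens (p 0) (q 2) + tens (p 1) (q 2)

/-- The sum of the tori `∂[0bc] × ∂[0a4]` for `{a, b, c} = {1, 2, 3}`; here `y i` is the edge
from `0` to `i + 1`, `g i` is the edge avoiding `0`, `i + 1` and `4`, `h i` is the edge from
`i + 1` to `4`, and `k` is the edge from `0` to `4`. -/
def tori (y g h : Fin 3 → Chain (Cell P)) (k : Chain (Cell P)) : Chain (Cell₂ P) :=
  tens (y 1 + y 2 + g 0) (y 0 + h 0 + k) + tens (y 0 + y 2 + g 1) (y 1 + h 1 + k) +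
    tens (y 0 + y 1 + g 2) (y 2 + h 2 + k)

variable {y g h v : Fin 3 → Chain (Cell P)} {k o t : Chain (Cell P)}

lemma boundary₂_offDiagonal (hy : ∀ i, boundary₁ (y i) = o + v i) :
    boundary₂ (offDiagonal y y) = offDiagonal v y + swap₂ (offDiagonal v y) := by
  refine eq_of_one_smul ?_
  simp only [offDiagonal, map_add, boundary₂_tens, hy, LinearMap.add_apply, swap₂_tens]
  match_scalars <;> rfl

lemma boundary₂_offDiagonal' (hy : ∀ i, boundary₁ (y i) = o + v i) (hv : ∀ i, boundary₁ (v i) = 0) :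
    boundary₂ (offDiagonal v y) = upperDiagonal v v + swap₂ (upperDiagonal v v) := by
  refine eq_of_one_smul ?_
  simp only [offDiagonal, upperDiagonal, map_add, boundary₂_tens, hy, hv,
    swap₂_tens, map_zero, LinearMap.zero_apply]
  match_scalars <;> rfl

lemma boundary₂_upperDiagonal (hv : ∀ i, boundary₁ (v i) = 0) :
    boundary₂ (upperDiagonal v v) = 0 := by
  simp only [upperDiagonal, map_add, boundary₂_tens, hv, map_zero, LinearMap.zero_apply, add_zero]

lemma boundary₂_tori (hy : ∀ i, boundary₁ (y i) = o + v i) (hk : boundary₁ k = o + t)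
    (hh : ∀ i, boundary₁ (h i) = v i + t) (hg₀ : boundary₁ (g 0) = v 1 + v 2)
    (hg₁ : boundary₁ (g 1) = v 0 + v 2) (hg₂ : boundary₁ (g 2) = v 0 + v 1) :
    boundary₂ (tori y g h k) = 0 := by
  have h1 : ∀ i, boundary₁ (y i + h i + k) = 0 := fun i => by
    refine eq_of_one_smul ?_
    simp only [map_add, hy, hh, hk]
    match_scalars <;> rfl
  have h2 : ∀ i j (c : Chain (Cell P)), boundary₁ c = v i + v j →
      boundary₁ (y i + y j + c) = 0 := fun i j c hc => by
    refine eq_of_one_smul ?_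
    simp only [map_add, hy, hc]
    match_scalars <;> rfl
  simp only [tori, map_add boundary₂, boundary₂_tens, h1, h2 _ _ _ hg₀, h2 _ _ _ hg₁, h2 _ _ _ hg₂,
    map_zero, LinearMap.zero_apply, add_zero]

lemma tori_add_offDiagonal : tori y g h k + offDiagonal y y =
    tens (g 0) (y 0) + tens (g 1) (y 1) + tens (g 2) (y 2) +
    (tens (g 0) (h 0) + tens (g 1) (h 1) + tens (g 2) (h 2)) +
    (tens (g 0) k + tens (g 1) k + tens (g 2) k) +
    (tens (y 1) (h 0) + tens (y 2) (h 0) + tens (y 0) (h 1) + tens (y 2) (h 1) +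
      tens (y 0) (h 2) + tens (y 1) (h 2)) := by
  refine eq_of_one_smul ?_
  simp only [tori, offDiagonal, map_add, LinearMap.add_apply]
  match_scalars <;> rfl

/-- The obstruction given by subdivided edges `e a b` of the complete graph on five vertices. -/
lemma exists_obstruction {v : Fin 5 → P} {e : Fin 5 → Fin 5 → Chain (Cell P)}
    {S : Fin 5 → Fin 5 → Set (Cell P)} {T U : Set (Cell₂ P)}
    (hbd : ∀ a b, boundary₁ (e a b) = basic (.pt (v a)) + basic (.pt (v b)))
    (haug : ∀ a b, aug₁ (e a b) = 0) (he : ∀ a b, e a b ∈ chainsIn (S a b))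
    (hS : ∀ a b, ∀ p ∈ S a b, p.dim = 1)
    (hT : ∀ p ∈ T, p.swap ∈ T) (hU : ∀ p ∈ U, p.swap ∈ U)
    (hTee : ∀ a b c d, ∀ p ∈ S a b, ∀ q ∈ S c d, (p, q) ∈ T)
    (hTve : ∀ a b c, ∀ p ∈ S b c, (.pt (v a), p) ∈ T)
    (hTvv : ∀ a b, (.pt (v a), .pt (v b)) ∈ T)
    (hUee : ∀ a b c d, a ≠ c ∧ a ≠ d ∧ b ≠ c ∧ b ≠ d →
      ∀ p ∈ S a b, ∀ q ∈ S c d, (p, q) ∈ U)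
    (hUve : ∀ a b c, a ≠ b ∧ a ≠ c → ∀ p ∈ S b c, (.pt (v a), p) ∈ U)
    (hUvv : ∀ a b, a ≠ b → (.pt (v a), .pt (v b)) ∈ U) :
    ∃ B H₁ H₀ Z, Obstruction T U B H₁ H₀ Z := by
  have hv : ∀ a, boundary₁ (basic (.pt (v a))) = 0 := fun a => by
    simp [boundary₁, botFace, topFace]
  have hvaug : ∀ a, aug₁ (basic (.pt (v a))) = 1 := fun a => by
    rw [aug₁, extend_basic]; rfl
  have hee : ∀ a b c d, tens (e a b) (e c d) ∈ chainsIn (T ∩ {p | p.1.dim + p.2.dim = 2}) :=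
    fun a b c d => bilin_mem (by
      exact fun p hp q hq => ⟨hTee a b c d p hp q hq, by
        rw [Set.mem_ofPred_eq, hS _ _ p hp, hS _ _ q hq]⟩) (he a b) (he c d)
  have hee' : ∀ a b c d, a ≠ c ∧ a ≠ d ∧ b ≠ c ∧ b ≠ d → tens (e a b) (e c d) ∈
      chainsIn (T ∩ U ∩ {p | p.1.dim + p.2.dim = 2}) :=
    fun a b c d h => bilin_mem (by
      exact fun p hp q hq => ⟨⟨hTee a b c d p hp q hq, hUee a b c d h p hp q hq⟩, by
        rw [Set.mem_ofPred_eq, hS _ _ p hp, hS _ _ q hq]⟩) (he a b) (he c d)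
  have hve : ∀ a b c, a ≠ b ∧ a ≠ c → tens (basic (.pt (v a))) (e b c) ∈ chainsIn (T ∩ U) :=
    fun a b c h => bilin_mem (S := {p | p = Cell.pt (v a)}) (by
      intro p hp q hq
      rw [show p = Cell.pt (v a) from hp]
      exact ⟨hTve a b c q hq, hUve a b c h q hq⟩) (basic_mem rfl) (he b c)
  have hvv : ∀ a b, a ≠ b → tens (basic (.pt (v a))) (basic (.pt (v b))) ∈ chainsIn (T ∩ U) :=
    fun a b h => by
      rw [bilin_basic]
      exact basic_mem ⟨hTvv a b, hUvv a b h⟩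
  let m : Fin 3 → Fin 5 := ![1, 2, 3]
  let y : Fin 3 → Chain (Cell P) := fun i => e 0 (m i)
  let g : Fin 3 → Chain (Cell P) := fun i => e (![2, 1, 1] i) (![3, 3, 2] i)
  let h : Fin 3 → Chain (Cell P) := fun i => e (m i) 4
  let V : Fin 3 → Chain (Cell P) := fun i => basic (.pt (v (m i)))
  have hyb : ∀ i, boundary₁ (y i) = basic (.pt (v 0)) + V i := fun i => hbd 0 (m i)
  have hVb : ∀ i, boundary₁ (V i) = 0 := fun i => hv _
  have hyaug : ∀ i, aug₁ (y i) = 0 := fun i => haug _ _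
  have hVaug : ∀ i, aug₁ (V i) = 1 := fun i => hvaug _
  refine ⟨offDiagonal y y, offDiagonal V y, upperDiagonal V V, tori y g h (e 0 4),
    boundary₂_offDiagonal hyb, boundary₂_offDiagonal' hyb hVb, boundary₂_upperDiagonal hVb,
    boundary₂_tori hyb (hbd 0 4) (fun i => hbd _ _) (hbd 2 3) (hbd 1 3) (hbd 1 2), ?_, ?_, ?_, ?_,
    ?_, ?_, ?_, ?_, hT, hU⟩
  · simp only [offDiagonal, map_add, swap₂_tens]
    abel
  · simp [offDiagonal, aug₂_tens, hyaug]
  · simp [offDiagonal, aug₂_tens, hyaug]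
  · simp only [upperDiagonal, map_add, aug₂_tens, hVaug]
    rfl
  · simp only [offDiagonal]
    repeat' refine add_mem ?_ ?_
    all_goals exact hee _ _ _ _
  · simp only [offDiagonal]
    repeat' refine add_mem ?_ ?_
    all_goals exact hve _ _ _ (by decide)
  · simp only [upperDiagonal]
    repeat' refine add_mem ?_ ?_
    all_goals exact hvv _ _ (by decide)
  · rw [tori_add_offDiagonal]
    repeat' refine add_mem ?_ ?_
    all_goals exact hee' _ _ _ _ (by decide)

end CompleteGraph

/-! ### Subdivided edges and labels -/

section Geometry

/-- A path, as a chain. -/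
def pathChain {P : Type*} (p : ℕ → P) (m : ℕ) : Chain (Cell P) :=
  ∑ j ∈ Finset.range m, basic (.seg (p j) (p (j + 1)))

lemma boundary₁_pathChain {P : Type*} (p : ℕ → P) (m : ℕ) :
    boundary₁ (pathChain p m) = basic (.pt (p 0)) + basic (.pt (p m)) := by
  induction m with
  | zero => simp [pathChain, add_self_eq_zero_of_zmod_two]
  | succ m ih =>
    have h : boundary₁ (basic (.seg (p m) (p (m + 1)))) =
        basic (.pt (p m)) + basic (.pt (p (m + 1))) := by
      rw [boundary₁, LinearMap.add_apply, botFace, topFace, extend_basic, extend_basic]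
    have h1 := add_self_eq_zero_of_zmod_two (basic (Cell.pt (p m)))
    rw [pathChain, Finset.sum_range_succ, ← pathChain, map_add, ih, h]
    linear_combination (norm := abel) h1

lemma aug₁_pathChain {P : Type*} (p : ℕ → P) (m : ℕ) : aug₁ (pathChain p m) = 0 := by
  rw [pathChain, map_sum]
  refine Finset.sum_eq_zero fun j _ => ?_
  rw [aug₁, extend_basic]
  rfl

lemma pathChain_mem {P : Type*} {p : ℕ → P} {m : ℕ} {S : Set (Cell P)}
    (h : ∀ j < m, .seg (p j) (p (j + 1)) ∈ S) : pathChain p m ∈ chainsIn S :=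
  sum_mem fun j hj => basic_mem (h j (Finset.mem_range.1 hj))

lemma dist_vert_le {V : Type*} [Fintype V] [DecidableEq V] (a b : V) :
    dist (vert a) (vert b) ≤ 1 := by
  refine (dist_pi_le_iff zero_le_one).2 fun i => ?_
  rw [Real.dist_eq]
  simp only [vert]
  split_ifs <;> simp

lemma half_le_dist_of_mem_segment {V : Type*} [Fintype V] [DecidableEq V] {a b c d : V}
    (h : a ≠ c ∧ a ≠ d ∧ b ≠ c ∧ b ≠ d) {x y : V → ℝ}
    (hx : x ∈ segment ℝ (vert a) (vert b)) (hy : y ∈ segment ℝ (vert c) (vert d)) :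
    1 / 2 ≤ dist x y := by
  obtain ⟨s, t, hs, ht, hst, rfl⟩ := hx
  obtain ⟨s', t', -, -, -, rfl⟩ := hy
  obtain ⟨hac, had, hbc, hbd⟩ := h
  rcases le_total (1 / 2) s with h | h
  · refine le_trans ?_ (dist_le_pi_dist _ _ a)
    rw [Real.dist_eq]
    refine le_trans ?_ (le_abs_self _)
    simp only [vert, Pi.add_apply, Pi.smul_apply, smul_eq_mul, if_neg hac, if_neg had, if_true]
    split_ifs <;> linarith
  · refine le_trans ?_ (dist_le_pi_dist _ _ b)
    rw [Real.dist_eq]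
    refine le_trans ?_ (le_abs_self _)
    simp only [vert, Pi.add_apply, Pi.smul_apply, smul_eq_mul, if_neg hbc, if_neg hbd, if_true]
    split_ifs <;> linarith

lemma segment_subset_graphRealization {V : Type*} [DecidableEq V] [Nontrivial V] (a b : V) :
    segment ℝ (vert a) (vert b) ⊆ graphRealization (⊤ : SimpleGraph V) := by
  have key : ∀ a b : V, a ≠ b →
      segment ℝ (vert a) (vert b) ⊆ graphRealization (⊤ : SimpleGraph V) := fun a b hab =>
    Set.subset_iUnion (fun p : {p : V × V // (⊤ : SimpleGraph V).Adj p.1 p.2} =>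
      segment ℝ (vert p.1.1) (vert p.1.2)) ⟨(a, b), hab⟩
  by_cases hab : a = b
  · subst hab
    obtain ⟨c, hc⟩ := exists_ne a
    rw [segment_same, Set.singleton_subset_iff]
    exact key a c hc.symm (left_mem_segment ℝ _ _)
  · exact key a b hab

lemma isCompact_graphRealization {V : Type*} [Finite V] [DecidableEq V] (G : SimpleGraph V) :
    IsCompact (graphRealization G) := by
  refine isCompact_iUnion fun p => ?_
  rw [segment_eq_image_lineMap]
  exact isCompact_Icc.image AffineMap.lineMap_continuous

/-- A discretisation of vectors outside of a cube by labels `±1, …, ±n`. -/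
def signedLabel {n : ℕ} [NeZero n] (ε : ℝ) (u : Fin n → ℝ) : ℤ :=
  let j : Fin n := Classical.epsilon fun j => ε ≤ |u j|
  if ε ≤ u j then (j : ℤ) + 1 else if u j ≤ -ε then -((j : ℤ) + 1) else 0

lemma signedLabel_neg {n : ℕ} [NeZero n] {ε : ℝ} (hε : 0 < ε) (u : Fin n → ℝ) :
    signedLabel ε (-u) = -signedLabel ε u := by
  simp only [signedLabel, Pi.neg_apply, abs_neg]
  generalize Classical.epsilon (fun j => ε ≤ |u j|) = j
  split_ifs <;> linarith

lemma natAbs_signedLabel_le {n : ℕ} [NeZero n] (ε : ℝ) (u : Fin n → ℝ) :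
    (signedLabel ε u).natAbs ≤ n := by
  simp only [signedLabel]
  generalize Classical.epsilon (fun j => ε ≤ |u j|) = j
  split_ifs <;> omega

lemma exists_of_signedLabel_add_eq_zero {n : ℕ} [NeZero n] {ε : ℝ} (hε : 0 < ε) {u u' : Fin n → ℝ}
    (hu : ε ≤ ‖u‖) (h : signedLabel ε u + signedLabel ε u' = 0) :
    ∃ j, 2 * ε ≤ |u j - u' j| := by
  have hj : ∃ j, ε ≤ |u j| := by
    by_contra! hlt
    exact hu.not_gt ((pi_norm_lt_iff hε).2 hlt)
  have hj' := Classical.epsilon_spec hj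
  simp only [signedLabel] at h
  generalize Classical.epsilon (fun j => ε ≤ |u j|) = j at h hj'
  generalize Classical.epsilon (fun j => ε ≤ |u' j|) = j' at h
  refine ⟨j, ?_⟩
  rw [le_abs] at hj' ⊢
  by_cases hjj : j = j'
  · subst hjj
    split_ifs at h <;> first | omega | grind
  · have hne : (j : ℕ) ≠ j' := fun h => hjj (Fin.ext h)
    split_ifs at h <;> first | omega | grind

end Geometry

/-! ### Nonexistence of an injective map -/

section Embedding

/-- The geometric realization of the complete graph on five vertices. -/
abbrev K5 : Set (Fin 5 → ℝ) := graphRealization (⊤ : SimpleGraph (Fin 5))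

lemma vert_mem_K5 (a : Fin 5) : vert a ∈ K5 :=
  segment_subset_graphRealization a a (left_mem_segment ℝ _ _)

open Classical in
/-- A retraction onto the realization. -/
def toK5 (x : Fin 5 → ℝ) : K5 := if h : x ∈ K5 then ⟨x, h⟩ else ⟨vert 0, vert_mem_K5 0⟩

lemma coe_toK5 {x : Fin 5 → ℝ} (h : x ∈ K5) : (toK5 x : Fin 5 → ℝ) = x := by
  rw [toK5, dif_pos h]

/-- Cells of `K5` of diameter less than `δ`. -/
def smallCells (δ : ℝ) : Set (Cell (Fin 5 → ℝ)) :=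
  {p | p.ends ⊆ K5 ∧ ∀ x ∈ p.ends, ∀ y ∈ p.ends, dist x y < δ}

/-- Pairs of cells at distance at least `1 / 2`. -/
def farCells : Set (Cell₂ (Fin 5 → ℝ)) :=
  {p | ∀ x ∈ p.1.ends, ∀ y ∈ p.2.ends, 1 / 2 ≤ dist x y}

/-- Short subsegments of an edge. -/
def edgeCells (δ : ℝ) (a b : Fin 5) : Set (Cell (Fin 5 → ℝ)) :=
  {p | p.dim = 1 ∧ p.ends ⊆ segment ℝ (vert a) (vert b) ∧
    ∀ x ∈ p.ends, ∀ y ∈ p.ends, dist x y < δ}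

lemma exists_edgeChain {δ : ℝ} (hδ : 0 < δ) (a b : Fin 5) :
    ∃ e : Chain (Cell (Fin 5 → ℝ)),
      boundary₁ e = basic (.pt (vert a)) + basic (.pt (vert b)) ∧ aug₁ e = 0 ∧
        e ∈ chainsIn (edgeCells δ a b) := by
  obtain ⟨m, hm⟩ := exists_nat_one_div_lt hδ
  have hm0 : (0 : ℝ) < m + 1 := by positivity
  let p : ℕ → Fin 5 → ℝ := fun j => AffineMap.lineMap (vert a) (vert b) ((j : ℝ) / (m + 1))
  refine ⟨pathChain p (m + 1), ?_, aug₁_pathChain _ _, pathChain_mem fun j hj => ?_⟩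
  · rw [boundary₁_pathChain]
    simp [p, div_self hm0.ne']
  · have hp : ∀ j : ℕ, j ≤ m + 1 → p j ∈ segment ℝ (vert a) (vert b) := fun j hj => by
      rw [segment_eq_image_lineMap]
      refine ⟨_, ⟨by positivity, ?_⟩, rfl⟩
      rw [div_le_one hm0]
      exact_mod_cast hj
    have hd : dist (p j) (p (j + 1)) < δ := by
      rw [dist_lineMap_lineMap]
      refine lt_of_le_of_lt (mul_le_of_le_one_right dist_nonneg (dist_vert_le a b)) ?_
      rw [Real.dist_eq, ← sub_div, abs_div, abs_of_pos hm0]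
      simpa using hm
    refine ⟨rfl, ?_, ?_⟩
    · simp [Cell.ends, Set.insert_subset_iff, hp j (by omega), hp (j + 1) (by omega)]
    · simp only [Cell.ends, Set.mem_insert_iff, Set.mem_singleton_iff]
      rintro x (rfl | rfl) y (rfl | rfl) <;> simp [hδ, hd, dist_comm (p (j + 1))]

lemma exists_obstruction_K5 {δ : ℝ} (hδ : 0 < δ) :
    ∃ B H₁ H₀ Z, Obstruction (smallCells δ ×ˢ smallCells δ) farCells B H₁ H₀ Z := by
  choose e hbd haug he using exists_edgeChain hδ
  have hedge : ∀ a b, edgeCells δ a b ⊆ smallCells δ := fun a b p hp =>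
    ⟨hp.2.1.trans (segment_subset_graphRealization a b), hp.2.2⟩
  have hpt : ∀ a : Fin 5, .pt (vert a) ∈ smallCells δ := fun a => by
    simp [smallCells, Cell.ends, vert_mem_K5, hδ]
  have hseg : ∀ (a : Fin 5), ∀ x ∈ (Cell.pt (vert a)).ends, x ∈ segment ℝ (vert a) (vert a) := by
    simp [Cell.ends]
  refine exists_obstruction hbd haug he (fun a b p hp => hp.1) (fun p hp => ⟨hp.2, hp.1⟩)
    (fun p hp x hx y hy => dist_comm y x ▸ hp y hy x hx)
    (fun a b c d p hp q hq => ⟨hedge a b hp, hedge c d hq⟩)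
    (fun a b c p hp => ⟨hpt a, hedge b c hp⟩) (fun a b => ⟨hpt a, hpt b⟩)
    (fun a b c d h p hp q hq x hx y hy => half_le_dist_of_mem_segment h (hp.2.1 hx) (hq.2.1 hy))
    (fun a b c h p hp x hx y hy => half_le_dist_of_mem_segment ⟨h.1, h.2, h.1, h.2⟩
      (hseg a x hx) (hp.2.1 hy))
    (fun a b h x hx y hy => half_le_dist_of_mem_segment ⟨h, h, h, h⟩ (hseg a x hx) (hseg b y hy))

lemma getD_mem_ends {P : Type*} {w : List (Cell₂ P)} {z : List (P × P)} (hz : z ∈ box w)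
    {i : ℕ} (hi : i < w.length) (d : P × P) :
    (z.getD i d).1 ∈ w[i].1.ends ∧ (z.getD i d).2 ∈ w[i].2.ends := by
  rw [box, Set.mem_ofPred_eq, List.forall₂_iff_get] at hz
  have hi' : i < z.length := hz.1 ▸ hi
  rw [List.getD_eq_getElem _ _ hi']
  exact hz.2 i hi hi'

theorem not_injective_of_continuous {n : ℕ} (hn : 0 < n) {g : (Fin n → K5) → Fin (2 * n) → ℝ}
    (hg : Continuous g) : ¬ Function.Injective g := by
  intro hinj
  have : CompactSpace K5 := isCompact_iff_compactSpace.1 (isCompact_graphRealization _)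
  have : NeZero (2 * n) := ⟨by omega⟩
  obtain ⟨ε, hε, hfar⟩ : ∃ ε, 0 < ε ∧ ∀ x y : Fin n → K5,
      (∃ i, 1 / 2 ≤ dist (x i) (y i)) → ε ≤ ‖g x - g y‖ := by
    have hK : IsClosed {q : (Fin n → K5) × (Fin n → K5) | ∃ i, 1 / 2 ≤ dist (q.1 i) (q.2 i)} := by
      rw [Set.ofPred_exists]
      exact isClosed_iUnion_of_finite fun i => isClosed_le (by fun_prop) (by fun_prop)
    obtain ⟨ε, hε, h⟩ := hK.isCompact.exists_forall_le' (f := fun q => ‖g q.1 - g q.2‖) (a := 0)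
      (by fun_prop) (fun q hq => by
        obtain ⟨i, hi⟩ := hq
        rw [norm_pos_iff, sub_ne_zero]
        intro h
        rw [hinj h, dist_self] at hi
        norm_num at hi)
    exact ⟨ε, hε, fun x y hxy => h (x, y) hxy⟩
  obtain ⟨δ, hδ, hclose⟩ := Metric.uniformContinuous_iff.1
    (CompactSpace.uniformContinuous_of_continuous hg) ε hε
  obtain ⟨B, H₁, H₀, Z, hobs⟩ := exists_obstruction_K5 hδ
  let x : List ((Fin 5 → ℝ) × (Fin 5 → ℝ)) → Fin n → K5 := fun z i => toK5 (z.getD i (0, 0)).1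
  let y : List ((Fin 5 → ℝ) × (Fin 5 → ℝ)) → Fin n → K5 := fun z i => toK5 (z.getD i (0, 0)).2
  have hswap : ∀ (z : List ((Fin 5 → ℝ) × (Fin 5 → ℝ))) (i : ℕ),
      (z.map Prod.swap).getD i (0, 0) = (z.getD i (0, 0)).swap :=
    fun z i => z.getD_map (f := Prod.swap) (d := (0, 0))
  refine hobs.not_labelling hn (lab := fun z => signedLabel ε (g (x z) - g (y z)))
    (fun z => ?_) (fun z => natAbs_signedLabel_le _ _) ?_
  · rw [← signedLabel_neg hε, neg_sub]
    simp only [x, y, hswap, Prod.fst_swap, Prod.snd_swap]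
  · rintro w ⟨⟨hlen, hsmall⟩, p, hp, hpfar⟩ z hz z' hz' hzero
    have hends : ∀ z ∈ box w, ∀ i : Fin n,
        (z.getD i (0, 0)).1 ∈ (w[i]'(hlen.symm ▸ i.2)).1.ends ∧
          (z.getD i (0, 0)).2 ∈ (w[i]'(hlen.symm ▸ i.2)).2.ends :=
      fun z hz i => getD_mem_ends hz _ _
    have hx : ∀ z ∈ box w, ∀ i, (x z i : Fin 5 → ℝ) = (z.getD i (0, 0)).1 := fun z hz i =>
      coe_toK5 ((hsmall _ (List.getElem_mem _)).1.1 (hends z hz i).1)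
    have hy : ∀ z ∈ box w, ∀ i, (y z i : Fin 5 → ℝ) = (z.getD i (0, 0)).2 := fun z hz i =>
      coe_toK5 ((hsmall _ (List.getElem_mem _)).2.1 (hends z hz i).2)
    have hxx : dist (g (x z)) (g (x z')) < ε := by
      refine hclose ((dist_pi_lt_iff hδ).2 fun i => ?_)
      rw [Subtype.dist_eq, hx z hz, hx z' hz']
      exact (hsmall _ (List.getElem_mem _)).1.2 _ (hends z hz i).1 _ (hends z' hz' i).1
    have hyy : dist (g (y z)) (g (y z')) < ε := by
      refine hclose ((dist_pi_lt_iff hδ).2 fun i => ?_)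
      rw [Subtype.dist_eq, hy z hz, hy z' hz']
      exact (hsmall _ (List.getElem_mem _)).2.2 _ (hends z hz i).2 _ (hends z' hz' i).2
    have hxy : ε ≤ ‖g (x z) - g (y z)‖ := by
      obtain ⟨i, hi, rfl⟩ := List.getElem_of_mem hp
      refine hfar _ _ ⟨⟨i, hlen ▸ hi⟩, ?_⟩
      rw [Subtype.dist_eq, hx z hz, hy z hz]
      exact hpfar _ (hends z hz ⟨i, hlen ▸ hi⟩).1 _ (hends z hz ⟨i, hlen ▸ hi⟩).2
    obtain ⟨j, hj⟩ := exists_of_signedLabel_add_eq_zero hε hxy hzero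
    have h1 := (dist_le_pi_dist (g (x z)) (g (x z')) j).trans_lt hxx
    have h2 := (dist_le_pi_dist (g (y z)) (g (y z')) j).trans_lt hyy
    rw [Real.dist_eq] at h1 h2
    simp only [Pi.sub_apply] at hj
    grind

end Embedding

end K5Power

/-- The product `(K₅)^N` of `N` copies of the complete graph on 5 vertices does not embed
topologically into `ℝ^{2N}`. -/
theorem K5_power_not_embeddable (N : ℕ) (hN : 0 < N) :
    ¬ ∃ f : (Fin N → ↥(graphRealization (⊤ : SimpleGraph (Fin 5)))) →
        EuclideanSpace ℝ (Fin (2 * N)),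
      Topology.IsEmbedding f := by
  rintro ⟨f, hf⟩
  refine K5Power.not_injective_of_continuous hN
    (g := fun x => WithLp.ofLp (f x)) ((PiLp.continuous_ofLp 2 _).comp hf.continuous) ?_
  exact (WithLp.ofLp_injective 2).comp hf.injective
end
end

section
/- For every positive integer N, the N-fold Cartesian product of the complete bipartite graph K₃,₃ with itself does not embed topologically into ℝ^{2N}. -/
open Set

noncomputable section

/-! ### Ky Fan's alternating labels -/

/-- The opposite of a signed label. -/
def negLabel {ι : Type*} (x : ι × Bool) : ι × Bool := (x.1, !x.2)

lemma negLabel_injective {ι : Type*} : Function.Injective (negLabel : ι × Bool → ι × Bool) := by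
  rintro ⟨i, a⟩ ⟨j, b⟩ h
  simpa [negLabel] using h

/-- `S` contains no two opposite labels. -/
def NoOpp {ι : Type*} (S : Finset (ι × Bool)) : Prop := Set.InjOn Prod.fst (S : Set (ι × Bool))

/-- In the order of the first coordinates, the signs in `S` alternate, beginning with `b`. -/
def Alternates {ι : Type*} [LinearOrder ι] (b : Bool) (S : Finset (ι × Bool)) : Prop :=
  ∀ s ∈ S, (s.2 = b ↔ Even (S.filter fun x => x.1 < s.1).card)

open Classical in
/-- The mod 2 indicator function of `Alternates b`. -/
def altInd {ι : Type*} [LinearOrder ι] (b : Bool) (S : Finset (ι × Bool)) : ZMod 2 :=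
  if Alternates b S then 1 else 0

lemma alternates_image_negLabel {ι : Type*} [LinearOrder ι] (b : Bool) (S : Finset (ι × Bool)) :
    Alternates b (S.image negLabel) ↔ Alternates (!b) S := by
  have h : ∀ s : ι × Bool, ((S.image negLabel).filter fun x => x.1 < s.1).card =
      (S.filter fun x => x.1 < s.1).card := by
    intro s
    rw [Finset.filter_image, Finset.card_image_of_injective _ negLabel_injective]
    rfl
  simp only [Alternates, Finset.forall_mem_image, h]
  refine forall₂_congr fun s _ => ?_
  rcases s with ⟨i, a⟩
  cases a <;> cases b <;> simp [negLabel]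

lemma alternates_insert {ι : Type*} [LinearOrder ι] (b : Bool) (a : ι × Bool)
    (S : Finset (ι × Bool)) (h : ∀ x ∈ S, a.1 < x.1) :
    Alternates b (insert a S) ↔ a.2 = b ∧ Alternates (!b) S := by
  have ha : a ∉ S := fun hs => lt_irrefl _ (h a hs)
  have h0 : ((insert a S).filter fun x => x.1 < a.1) = ∅ := by
    ext x
    simp only [Finset.mem_filter, Finset.mem_insert, Finset.notMem_empty, iff_false, not_and]
    rintro (rfl | hx)
    · exact lt_irrefl _
    · exact (h x hx).not_gt
  have h1 : ∀ s ∈ S, ((insert a S).filter fun x => x.1 < s.1).card =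
      (S.filter fun x => x.1 < s.1).card + 1 := by
    intro s hs
    rw [Finset.filter_insert, if_pos (h s hs), Finset.card_insert_of_notMem]
    exact fun h' => ha (Finset.mem_filter.1 h').1
  simp only [Alternates, Finset.forall_mem_insert, h0]
  refine and_congr (by simp) (forall₂_congr fun s hs => ?_)
  rw [h1 s hs, Nat.even_add_one]
  cases s.2 <;> cases b <;> simp

lemma altInd_insert {ι : Type*} [LinearOrder ι] (b : Bool) (a : ι × Bool)
    (S : Finset (ι × Bool)) (h : ∀ x ∈ S, a.1 < x.1) :
    altInd b (insert a S) = if a.2 = b then altInd (!b) S else 0 := by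
  unfold altInd
  rw [alternates_insert b a S h]
  split_ifs <;> simp_all

/-- Ky Fan's lemma for one simplex. -/
lemma sum_altInd_erase {ι : Type*} [LinearOrder ι] (S : Finset (ι × Bool)) (hS : NoOpp S)
    (b : Bool) : ∑ s ∈ S, altInd b (S.erase s) = altInd b S + altInd (!b) S := by
  refine Finset.induction_on_min_value (α := ι) (motive := fun S => NoOpp S → ∀ b,
    ∑ s ∈ S, altInd b (S.erase s) = altInd b S + altInd (!b) S) Prod.fst S ?_ ?_ hS b
  · simp [altInd, Alternates, CharTwo.add_self_eq_zero]
  · intro a S ha hmin ih hS b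
    have hlt : ∀ x ∈ S, a.1 < x.1 := fun x hx => lt_of_le_of_ne (hmin x hx) fun he =>
      ha (hS (by simp) (by simp [hx]) he ▸ hx)
    have hS' : NoOpp S := hS.mono (by simp)
    rw [Finset.sum_insert ha, Finset.erase_insert ha]
    have : ∀ s ∈ S, altInd b ((insert a S).erase s) =
        if a.2 = b then altInd (!b) (S.erase s) else 0 := by
      intro s hs
      rw [Finset.erase_insert_of_ne (by rintro rfl; exact ha hs),
        altInd_insert b a _ fun x hx => hlt x (Finset.mem_of_mem_erase hx)]
    rw [Finset.sum_congr rfl this, altInd_insert b a S hlt, altInd_insert (!b) a S hlt]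
    by_cases h : a.2 = b
    · simp only [h, if_true, ih hS', Bool.not_not]
      have h2 := CharTwo.add_self_eq_zero (altInd b S)
      cases b <;> simp at * <;> linear_combination h2
    · have : a.2 = !b := by revert h; cases a.2 <;> cases b <;> simp
      simp [this]

/-! ### Chains of labels -/

/-- Mod 2 augmented simplicial chains on a vertex set `Λ`. -/
abbrev FinsetChain (Λ : Type*) := Finset Λ →₀ ZMod 2

/-- The (augmented) simplicial boundary. -/
def simplexBd (Λ : Type*) [DecidableEq Λ] : FinsetChain Λ →ₗ[ZMod 2] FinsetChain Λ :=
  Finsupp.linearCombination (ZMod 2) fun S => ∑ s ∈ S, Finsupp.single (S.erase s) 1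

/-- The cone with apex `v`. -/
def simplexCone {Λ : Type*} [DecidableEq Λ] (v : Λ) : FinsetChain Λ →ₗ[ZMod 2] FinsetChain Λ :=
  Finsupp.linearCombination (ZMod 2) fun S => if v ∈ S then 0 else Finsupp.single (insert v S) 1

/-- The involution induced by changing all signs. -/
def simplexNeg (ι : Type*) [DecidableEq ι] :
    FinsetChain (ι × Bool) →ₗ[ZMod 2] FinsetChain (ι × Bool) :=
  Finsupp.lmapDomain (ZMod 2) (ZMod 2) fun S : Finset (ι × Bool) => S.image negLabel

/-- The Ky Fan cochain, counting alternating simplices whose first sign is positive. -/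
def fanCochain (ι : Type*) [LinearOrder ι] : FinsetChain (ι × Bool) →ₗ[ZMod 2] ZMod 2 :=
  Finsupp.linearCombination (ZMod 2) (altInd true)

lemma simplexBd_simplexCone {Λ : Type*} [DecidableEq Λ] (v : Λ) (x : FinsetChain Λ) :
    simplexBd Λ (simplexCone v x) = x + simplexCone v (simplexBd Λ x) := by
  suffices h : simplexBd Λ ∘ₗ simplexCone v = LinearMap.id + simplexCone v ∘ₗ simplexBd Λ from
    LinearMap.congr_fun h x
  refine Finsupp.lhom_ext' fun S => LinearMap.ext_ring ?_
  simp only [LinearMap.comp_apply, LinearMap.add_apply, LinearMap.id_apply,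
    Finsupp.lsingle_apply, simplexBd, simplexCone, Finsupp.linearCombination_single, one_smul,
    map_sum]
  by_cases hv : v ∈ S
  · rw [if_pos hv, map_zero, Finset.sum_eq_single_of_mem v hv]
    · rw [if_neg (Finset.notMem_erase v S), Finset.insert_erase hv, ← Finsupp.single_add,
        CharTwo.add_self_eq_zero, Finsupp.single_zero]
    · intro s _ hs
      simp [hv, hs.symm]
  · rw [if_neg hv, Finsupp.linearCombination_single, one_smul, Finset.sum_insert hv,
      Finset.erase_insert hv]
    congr 1
    refine Finset.sum_congr rfl fun s hs => ?_
    have hne : v ≠ s := by rintro rfl; exact hv hs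
    simp [hv, Finset.erase_insert_of_ne hne]

lemma simplexNeg_simplexCone {ι : Type*} [DecidableEq ι] (v : ι × Bool)
    (x : FinsetChain (ι × Bool)) :
    simplexNeg ι (simplexCone v x) = simplexCone (negLabel v) (simplexNeg ι x) := by
  suffices h : simplexNeg ι ∘ₗ simplexCone v = simplexCone (negLabel v) ∘ₗ simplexNeg ι from
    LinearMap.congr_fun h x
  refine Finsupp.lhom_ext' fun S => LinearMap.ext_ring ?_
  simp only [LinearMap.comp_apply, Finsupp.lsingle_apply, simplexNeg, simplexCone,
    Finsupp.linearCombination_single, one_smul, Finsupp.lmapDomain_apply, Finsupp.mapDomain_single]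
  have : negLabel v ∈ S.image negLabel ↔ v ∈ S := by
    simp [Finset.mem_image, negLabel_injective.eq_iff]
  by_cases hv : v ∈ S
  · simp [hv, this]
  · simp [hv, this, Finset.image_insert]

lemma fanCochain_add_neg {ι : Type*} [LinearOrder ι] {x : FinsetChain (ι × Bool)}
    (hx : x ∈ Finsupp.supported (ZMod 2) (ZMod 2) {S | NoOpp S}) :
    fanCochain ι x + fanCochain ι (simplexNeg ι x) = fanCochain ι (simplexBd _ x) := by
  rw [Finsupp.supported_eq_span_single] at hx
  suffices h : Set.EqOn (fanCochain ι + fanCochain ι ∘ₗ simplexNeg ι)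
      (fanCochain ι ∘ₗ simplexBd _) _ from LinearMap.eqOn_span h hx
  rintro _ ⟨S, hS, rfl⟩
  have : altInd true (S.image negLabel) = altInd false S := by
    unfold altInd
    classical exact if_congr (alternates_image_negLabel true S) rfl rfl
  simp [fanCochain, simplexBd, simplexNeg, this, sum_altInd_erase S hS, Finsupp.mapDomain_single]

lemma simplexCone_mem_supported {Λ : Type*} [DecidableEq Λ] (v : Λ) {s t : Set (Finset Λ)}
    (h : ∀ S ∈ s, v ∉ S → insert v S ∈ t) {x : FinsetChain Λ}
    (hx : x ∈ Finsupp.supported (ZMod 2) (ZMod 2) s) :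
    simplexCone v x ∈ Finsupp.supported (ZMod 2) (ZMod 2) t := by
  rw [Finsupp.supported_eq_span_single] at hx
  induction hx using Submodule.span_induction with
  | mem x hx =>
    obtain ⟨S, hS, rfl⟩ := hx
    simp only [simplexCone, Finsupp.linearCombination_single, one_smul]
    split_ifs with hv
    · exact zero_mem _
    · exact Finsupp.single_mem_supported _ _ (h S hS hv)
  | zero => simp
  | add x y _ _ hx hy => rw [map_add]; exact add_mem hx hy
  | smul a x _ hx => rw [map_smul]; exact Submodule.smul_mem _ _ hx

/-! ### Chains on products of squares of a graph -/

/-- The cells of the graph with vertex set `V` and one edge for each pair related by `r`. -/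
abbrev Cell {V : Type*} (r : V → V → Prop) := V ⊕ {p : V × V // r p.1 p.2}

namespace Cell

variable {V : Type*} {r : V → V → Prop}

/-- The vertices of a cell. -/
def verts : Cell r → Set V
  | .inl x => {x}
  | .inr p => {p.1.1, p.1.2}

/-- The first vertex of a cell. -/
def base : Cell r → V
  | .inl x => x
  | .inr p => p.1.1

/-- The dimension of a cell. -/
def dim : Cell r → ℕ
  | .inl _ => 0
  | .inr _ => 1

/-- The boundary of a cell. -/
def bd : Cell r → (Cell r →₀ ZMod 2)
  | .inl _ => 0
  | .inr p => Finsupp.single (.inl p.1.1) 1 + Finsupp.single (.inl p.1.2) 1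

lemma base_mem_verts (c : Cell r) : c.base ∈ c.verts := by
  rcases c with x | p <;> simp [base, verts]

end Cell

/-- The cells of the square of a graph. -/
abbrev Letter {V : Type*} (r : V → V → Prop) := Cell r × Cell r

/-- Mod 2 chains on the powers of the square of a graph: a word of length `N` in the cells of the
square is a cell of its `N`-th power, and concatenation is the cross product. -/
abbrev WordChain {V : Type*} (r : V → V → Prop) := MonoidAlgebra (ZMod 2) (FreeMonoid (Letter r))

section Words

variable {V : Type*} {r : V → V → Prop}

/-- A word as a chain. -/
def word (l : List (Letter r)) : WordChain r := MonoidAlgebra.single (FreeMonoid.ofList l) 1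

lemma word_append (l m : List (Letter r)) : word (l ++ m) = word l * word m := by
  simp [word, MonoidAlgebra.single_mul_single]

lemma word_cons (c : Letter r) (l : List (Letter r)) : word (c :: l) = word [c] * word l :=
  word_append [c] l

lemma word_nil : word ([] : List (Letter r)) = 1 := rfl

/-- Linear extension of a function on words. -/
def wordLift {M : Type*} [AddCommGroup M] [Module (ZMod 2) M] (g : List (Letter r) → M) :
    WordChain r →ₗ[ZMod 2] M :=
  Finsupp.linearCombination (ZMod 2) (fun w : FreeMonoid (Letter r) => g w.toList) ∘ₗ
    (MonoidAlgebra.coeffLinearEquiv (ZMod 2)).toLinearMap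

lemma wordLift_word {M : Type*} [AddCommGroup M] [Module (ZMod 2) M] (g : List (Letter r) → M)
    (l : List (Letter r)) : wordLift g (word l) = g l := by
  simp [wordLift, word]

lemma wordChain_hom_ext {M : Type*} [AddCommGroup M] [Module (ZMod 2) M]
    {f g : WordChain r →ₗ[ZMod 2] M} (h : ∀ l, f (word l) = g (word l)) : f = g :=
  MonoidAlgebra.lhom_ext' fun l => LinearMap.ext_ring (h (FreeMonoid.toList l))

/-- The chains supported on words satisfying `p`. -/
def wordSpan (p : List (Letter r) → Prop) : Submodule (ZMod 2) (WordChain r) :=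
  Submodule.span (ZMod 2) (word '' {l | p l})

lemma word_mem_wordSpan {p : List (Letter r) → Prop} {l : List (Letter r)} (h : p l) :
    word l ∈ wordSpan p := Submodule.subset_span ⟨l, h, rfl⟩

lemma wordSpan_le {p : List (Letter r) → Prop} {M : Submodule (ZMod 2) (WordChain r)}
    (h : ∀ l, p l → word l ∈ M) : wordSpan p ≤ M := by
  refine Submodule.span_le.2 ?_
  rintro _ ⟨l, hl, rfl⟩
  exact h l hl

lemma wordSpan_mono {p q : List (Letter r) → Prop} (h : ∀ l, p l → q l) :
    wordSpan p ≤ wordSpan q := wordSpan_le fun l hl => word_mem_wordSpan (h l hl)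

lemma mul_mem_wordSpan {p q s : List (Letter r) → Prop}
    (h : ∀ l m, p l → q m → s (l ++ m)) {x y : WordChain r} (hx : x ∈ wordSpan p)
    (hy : y ∈ wordSpan q) : x * y ∈ wordSpan s := by
  suffices H : wordSpan p ≤ (wordSpan s).comap (LinearMap.mulRight (ZMod 2) y) from H hx
  refine wordSpan_le fun l hl => ?_
  suffices H : wordSpan q ≤ (wordSpan s).comap (LinearMap.mulLeft (ZMod 2) (word l)) from H hy
  refine wordSpan_le fun m hm => ?_
  simpa [word_append] using word_mem_wordSpan (h l m hl hm)

/-- The cross product of two chains of the graph. -/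
def cross : (Cell r →₀ ZMod 2) →ₗ[ZMod 2] (Cell r →₀ ZMod 2) →ₗ[ZMod 2] WordChain r :=
  Finsupp.linearCombination (ZMod 2) fun c =>
    Finsupp.linearCombination (ZMod 2) fun c' => word [(c, c')]

lemma cross_single_single (c c' : Cell r) :
    cross (Finsupp.single c 1) (Finsupp.single c' 1) = word [(c, c')] := by
  simp [cross]

lemma cross_mem_wordSpan {p : List (Letter r) → Prop} {s t : Set (Cell r)}
    (h : ∀ c ∈ s, ∀ c' ∈ t, p [(c, c')]) {x y : Cell r →₀ ZMod 2}
    (hx : x ∈ Finsupp.supported (ZMod 2) (ZMod 2) s)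
    (hy : y ∈ Finsupp.supported (ZMod 2) (ZMod 2) t) : cross x y ∈ wordSpan p := by
  rw [Finsupp.supported_eq_span_single] at hx hy
  suffices H : Submodule.span (ZMod 2) _ ≤ (wordSpan p).comap (cross.flip y) from H hx
  refine Submodule.span_le.2 ?_
  rintro _ ⟨c, hc, rfl⟩
  suffices H : Submodule.span (ZMod 2) _ ≤
    (wordSpan p).comap (cross (Finsupp.single c 1)) from H hy
  refine Submodule.span_le.2 ?_
  rintro _ ⟨c', hc', rfl⟩
  simpa [cross_single_single] using word_mem_wordSpan (h c hc c' hc')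

/-- The boundary of a cell of the square. -/
def letterBd (c : Letter r) : WordChain r :=
  cross c.1.bd (Finsupp.single c.2 1) + cross (Finsupp.single c.1 1) c.2.bd

/-- The boundary of a word. -/
def wordBd : List (Letter r) → WordChain r
  | [] => 0
  | c :: l => letterBd c * word l + word [c] * wordBd l

/-- The boundary operator. -/
def chainBd : WordChain r →ₗ[ZMod 2] WordChain r := wordLift wordBd

lemma chainBd_word (l : List (Letter r)) : chainBd (word l) = wordBd l := wordLift_word _ _

lemma wordBd_append (l m : List (Letter r)) :
    wordBd (l ++ m) = wordBd l * word m + word l * wordBd m := by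
  induction l with
  | nil => simp [wordBd, word_nil]
  | cons c l ih =>
    rw [List.cons_append, wordBd, ih, wordBd, word_append, word_cons c l]
    noncomm_ring

lemma chainBd_mul (x y : WordChain r) :
    chainBd (x * y) = chainBd x * y + x * chainBd y := by
  suffices h : (LinearMap.mul (ZMod 2) (WordChain r)).compr₂ chainBd =
      (LinearMap.mul (ZMod 2) (WordChain r)) ∘ₗ chainBd +
        (LinearMap.mul (ZMod 2) (WordChain r)).compl₂ chainBd from
    LinearMap.congr_fun (LinearMap.congr_fun h x) y
  refine wordChain_hom_ext fun l => wordChain_hom_ext fun m => ?_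
  simp [← word_append, chainBd_word, wordBd_append]

lemma chainBd_one : chainBd (1 : WordChain r) = 0 := by
  rw [← word_nil, chainBd_word, wordBd]

lemma wordChain_add_self (x : WordChain r) : x + x = 0 := by
  rw [← two_smul (ZMod 2), show (2 : ZMod 2) = 0 from rfl, zero_smul]

/-- The boundary of a chain of the graph. -/
def cellBd : (Cell r →₀ ZMod 2) →ₗ[ZMod 2] (Cell r →₀ ZMod 2) :=
  Finsupp.linearCombination (ZMod 2) Cell.bd

lemma chainBd_cross (x y : Cell r →₀ ZMod 2) :
    chainBd (cross x y) = cross (cellBd x) y + cross x (cellBd y) := by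
  suffices h : cross.compr₂ chainBd = cross ∘ₗ cellBd + cross.compl₂ (cellBd (r := r)) from
    LinearMap.congr_fun (LinearMap.congr_fun h x) y
  refine Finsupp.lhom_ext' fun c => LinearMap.ext_ring <| Finsupp.lhom_ext' fun c' =>
    LinearMap.ext_ring ?_
  simp [cross_single_single, chainBd_word, wordBd, letterBd, cellBd, word_nil]

lemma cellBd_cellBd (x : Cell r →₀ ZMod 2) : cellBd (cellBd x) = 0 := by
  suffices h : cellBd ∘ₗ cellBd = (0 : (Cell r →₀ ZMod 2) →ₗ[ZMod 2] _) from
    LinearMap.congr_fun h x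
  refine Finsupp.lhom_ext' fun c => LinearMap.ext_ring ?_
  rcases c with x | p <;> simp [cellBd, Cell.bd]

lemma chainBd_letterBd (c : Letter r) : chainBd (letterBd c) = 0 := by
  have h : ∀ c : Cell r, c.bd = cellBd (Finsupp.single c 1) := fun c => by simp [cellBd]
  simp only [letterBd, map_add, chainBd_cross, h, cellBd_cellBd, map_zero, LinearMap.zero_apply,
    zero_add, add_zero, wordChain_add_self]

lemma chainBd_chainBd (x : WordChain r) : chainBd (chainBd x) = 0 := by
  suffices h : chainBd ∘ₗ chainBd = (0 : WordChain r →ₗ[ZMod 2] _) from LinearMap.congr_fun h x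
  refine wordChain_hom_ext fun l => ?_
  simp only [LinearMap.comp_apply, chainBd_word, LinearMap.zero_apply]
  induction l with
  | nil => simp [wordBd]
  | cons c l ih =>
    have hc : chainBd (word [c]) = letterBd c := by simp [chainBd_word, wordBd, word_nil]
    rw [wordBd, map_add, chainBd_mul, chainBd_mul, chainBd_letterBd, ih, hc, chainBd_word]
    simp [wordChain_add_self]

/-- The involution exchanging the two factors of the square. -/
def chainSwap : WordChain r →ₐ[ZMod 2] WordChain r :=
  MonoidAlgebra.mapDomainAlgHom (ZMod 2) (ZMod 2) (FreeMonoid.map Prod.swap)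

lemma chainSwap_word (l : List (Letter r)) : chainSwap (word l) = word (l.map Prod.swap) := by
  simp [chainSwap, word, FreeMonoid.ofList_map]

lemma chainSwap_chainSwap (x : WordChain r) : chainSwap (chainSwap x) = x := by
  suffices h : chainSwap.toLinearMap ∘ₗ chainSwap.toLinearMap =
    (LinearMap.id : WordChain r →ₗ[ZMod 2] _) from LinearMap.congr_fun h x
  refine wordChain_hom_ext fun l => ?_
  simp [chainSwap_word]

lemma chainSwap_cross (x y : Cell r →₀ ZMod 2) : chainSwap (cross x y) = cross y x := by
  suffices h : cross.compr₂ (chainSwap (r := r)).toLinearMap = cross.flip from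
    LinearMap.congr_fun (LinearMap.congr_fun h x) y
  refine Finsupp.lhom_ext' fun c => LinearMap.ext_ring <| Finsupp.lhom_ext' fun c' =>
    LinearMap.ext_ring ?_
  simp [cross_single_single, chainSwap_word]

lemma chainSwap_chainBd (x : WordChain r) : chainSwap (chainBd x) = chainBd (chainSwap x) := by
  suffices h : chainSwap.toLinearMap ∘ₗ chainBd =
    (chainBd (r := r)) ∘ₗ chainSwap.toLinearMap from LinearMap.congr_fun h x
  refine wordChain_hom_ext fun l => ?_
  simp only [LinearMap.comp_apply, AlgHom.toLinearMap_apply, chainBd_word, chainSwap_word]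
  induction l with
  | nil => simp [wordBd]
  | cons c l ih =>
    have hc : chainSwap (letterBd c) = letterBd c.swap := by
      simp [letterBd, chainSwap_cross, add_comm]
    simp [wordBd, ih, chainSwap_word, hc]

/-- The augmentation. -/
def chainAug : WordChain r →ₐ[ZMod 2] ZMod 2 :=
  MonoidAlgebra.lift (ZMod 2) (ZMod 2) (FreeMonoid (Letter r))
    (FreeMonoid.lift fun c => if c.1.dim + c.2.dim = 0 then 1 else 0)

/-- The dimension of a word. -/
def wordDim (l : List (Letter r)) : ℕ := (l.map fun c => c.1.dim + c.2.dim).sum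

lemma chainAug_word (l : List (Letter r)) :
    chainAug (word l) = if wordDim l = 0 then 1 else 0 := by
  induction l with
  | nil => simp [word_nil, wordDim]
  | cons c l ih =>
    have : chainAug (word [c]) = if c.1.dim + c.2.dim = 0 then 1 else 0 := by
      simp [chainAug, word]
    rw [word_cons, map_mul, ih, this]
    simp only [wordDim, List.map_cons, List.sum_cons]
    split_ifs <;> simp_all

lemma chainAug_chainBd (x : WordChain r) : chainAug (chainBd x) = 0 := by
  suffices h : chainAug.toLinearMap ∘ₗ chainBd = (0 : WordChain r →ₗ[ZMod 2] _) from
    LinearMap.congr_fun h x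
  refine wordChain_hom_ext fun l => ?_
  simp only [LinearMap.comp_apply, AlgHom.toLinearMap_apply, chainBd_word, LinearMap.zero_apply]
  induction l with
  | nil => simp [wordBd]
  | cons c l ih =>
    have hc : chainAug (letterBd c) = 0 := by
      rcases c with ⟨c, c'⟩
      rcases c with x | p <;> rcases c' with x' | p' <;>
        simp [letterBd, Cell.bd, cross_single_single, chainAug_word, wordDim, Cell.dim,
          CharTwo.add_self_eq_zero]
    simp [wordBd, ih, hc]

lemma chainAug_chainSwap (x : WordChain r) : chainAug (chainSwap x) = chainAug x := by
  suffices h : chainAug.toLinearMap ∘ₗ chainSwap.toLinearMap =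
    (chainAug (r := r)).toLinearMap from LinearMap.congr_fun h x
  refine wordChain_hom_ext fun l => ?_
  simp [chainSwap_word, chainAug_word, wordDim, Function.comp_def, add_comm]

/-- The vertices of a word. -/
def wordVerts (l : List (Letter r)) : Set (List (V × V)) :=
  {v | List.Forall₂ (fun q c => q.1 ∈ c.1.verts ∧ q.2 ∈ c.2.verts) v l}

/-- The base vertex of a word. -/
def wordBase (l : List (Letter r)) : List (V × V) := l.map fun c => (c.1.base, c.2.base)

lemma wordBase_mem_wordVerts (l : List (Letter r)) : wordBase l ∈ wordVerts l := by
  induction l with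
  | nil => exact .nil
  | cons c l ih => exact .cons ⟨c.1.base_mem_verts, c.2.base_mem_verts⟩ ih

lemma wordBase_map_swap (l : List (Letter r)) :
    wordBase (l.map Prod.swap) = (wordBase l).map Prod.swap := by
  simp [wordBase, Function.comp_def]

/-- `l'` is a word of the same length as `l`, of dimension one less and contained in `l`. -/
def IsFace (l' l : List (Letter r)) : Prop :=
  l'.length = l.length ∧ wordDim l' + 1 = wordDim l ∧ wordVerts l' ⊆ wordVerts l

lemma mem_wordVerts_append {l m : List (Letter r)} {v : List (V × V)} :
    v ∈ wordVerts (l ++ m) ↔ ∃ v₁ ∈ wordVerts l, ∃ v₂ ∈ wordVerts m, v = v₁ ++ v₂ := by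
  constructor
  · intro h
    refine ⟨_, List.forall₂_take_append _ _ _ h, _, List.forall₂_drop_append _ _ _ h,
      (List.take_append_drop _ _).symm⟩
  · rintro ⟨v₁, h₁, v₂, h₂, rfl⟩
    exact List.rel_append h₁ h₂

lemma IsFace.append_right {l' l : List (Letter r)} (h : IsFace l' l) (m : List (Letter r)) :
    IsFace (l' ++ m) (l ++ m) := by
  refine ⟨by simp [h.1], ?_, fun v hv => ?_⟩
  · have := h.2.1
    simp only [wordDim, List.map_append, List.sum_append] at *
    omega
  · obtain ⟨v₁, h₁, v₂, h₂, rfl⟩ := mem_wordVerts_append.1 hv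
    exact mem_wordVerts_append.2 ⟨v₁, h.2.2 h₁, v₂, h₂, rfl⟩

lemma IsFace.append_left {l' l : List (Letter r)} (h : IsFace l' l) (m : List (Letter r)) :
    IsFace (m ++ l') (m ++ l) := by
  refine ⟨by simp [h.1], ?_, fun v hv => ?_⟩
  · have := h.2.1
    simp only [wordDim, List.map_append, List.sum_append] at *
    omega
  · obtain ⟨v₁, h₁, v₂, h₂, rfl⟩ := mem_wordVerts_append.1 hv
    exact mem_wordVerts_append.2 ⟨v₁, h₁, v₂, h.2.2 h₂, rfl⟩

lemma bd_mem_supported (c : Cell r) : c.bd ∈ Finsupp.supported (ZMod 2) (ZMod 2)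
    {c' | c'.dim + 1 = c.dim ∧ c'.verts ⊆ c.verts} := by
  rcases c with x | p
  · exact zero_mem _
  · refine add_mem (Finsupp.single_mem_supported _ _ ?_) (Finsupp.single_mem_supported _ _ ?_) <;>
      simp [Cell.dim, Cell.verts]

lemma letterBd_mem (c : Letter r) : letterBd c ∈ wordSpan (IsFace · [c]) := by
  refine add_mem
    (cross_mem_wordSpan ?_ (bd_mem_supported c.1) (Finsupp.single_mem_supported _ _ rfl))
    (cross_mem_wordSpan ?_ (Finsupp.single_mem_supported _ _ rfl) (bd_mem_supported c.2))
  · rintro d ⟨hd, hv⟩ _ rfl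
    refine ⟨rfl, by simp [wordDim]; omega, fun v hv' => ?_⟩
    cases hv' with | cons h h' => exact .cons ⟨hv h.1, h.2⟩ h'
  · rintro _ rfl d ⟨hd, hv⟩
    refine ⟨rfl, by simp [wordDim]; omega, fun v hv' => ?_⟩
    cases hv' with | cons h h' => exact .cons ⟨h.1, hv h.2⟩ h'

lemma wordBd_mem (l : List (Letter r)) : wordBd l ∈ wordSpan (IsFace · l) := by
  induction l with
  | nil => exact zero_mem _
  | cons c l ih =>
    refine add_mem
      (mul_mem_wordSpan (q := (· = l)) ?_ (letterBd_mem c) (word_mem_wordSpan rfl))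
      (mul_mem_wordSpan (p := (· = [c])) ?_ (word_mem_wordSpan rfl) ih)
    · rintro l' _ h rfl
      exact h.append_right _
    · rintro _ l' rfl h
      exact h.append_left [c]

lemma chainBd_mem {p : List (Letter r) → Prop} (hp : ∀ l l', p l → IsFace l' l → p l')
    {x : WordChain r} (hx : x ∈ wordSpan p) : chainBd x ∈ wordSpan p := by
  suffices h : wordSpan p ≤ (wordSpan p).comap chainBd from h hx
  refine wordSpan_le fun l hl => ?_
  rw [Submodule.mem_comap, chainBd_word]
  exact wordSpan_mono (fun l' hl' => hp l l' hl hl') (wordBd_mem l)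

end Words

/-! ### The parity argument -/

section Labelling

variable {V : Type*} {r : V → V → Prop}

/-- The chain map induced by a labelling of the vertices, in dimensions less than `k`. -/
def labelChain {Λ : Type*} [DecidableEq Λ] (ℓ : List (V × V) → Λ) :
    ℕ → WordChain r →ₗ[ZMod 2] FinsetChain Λ
  | 0 => 0
  | k + 1 => wordLift fun w => simplexCone (ℓ (wordBase w))
      (labelChain ℓ k (wordBd w) + chainAug (word w) • Finsupp.single ∅ 1)

lemma labelChain_zero {Λ : Type*} [DecidableEq Λ] (ℓ : List (V × V) → Λ) (x : WordChain r) :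
    labelChain ℓ 0 x = 0 := rfl

lemma labelChain_succ_word {Λ : Type*} [DecidableEq Λ] (ℓ : List (V × V) → Λ) (k : ℕ)
    (w : List (Letter r)) :
    labelChain ℓ (k + 1) (word w) = simplexCone (ℓ (wordBase w))
      (labelChain ℓ k (wordBd w) + chainAug (word w) • Finsupp.single ∅ 1) :=
  wordLift_word _ _

lemma simplexBd_labelChain {Λ : Type*} [DecidableEq Λ] (ℓ : List (V × V) → Λ) (k : ℕ)
    (x : WordChain r) : simplexBd Λ (labelChain ℓ (k + 1) x) =
      labelChain ℓ k (chainBd x) + chainAug x • Finsupp.single ∅ 1 := by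
  induction k generalizing x with
  | zero =>
    suffices h : simplexBd Λ ∘ₗ labelChain ℓ 1 = labelChain ℓ 0 ∘ₗ chainBd +
      chainAug.toLinearMap.smulRight (Finsupp.single (∅ : Finset Λ) (1 : ZMod 2)) from
        LinearMap.congr_fun h x
    refine wordChain_hom_ext fun w => ?_
    have h₁ : simplexBd Λ (Finsupp.single ∅ 1) = 0 := by simp [simplexBd]
    simp only [LinearMap.comp_apply, labelChain_succ_word, simplexBd_simplexCone, labelChain_zero,
      zero_add, map_smul, h₁, map_zero, add_zero,
      LinearMap.add_apply, LinearMap.smulRight_apply, AlgHom.toLinearMap_apply]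
  | succ k ih =>
    suffices h : simplexBd Λ ∘ₗ labelChain ℓ (k + 2) = labelChain ℓ (k + 1) ∘ₗ chainBd +
      chainAug.toLinearMap.smulRight (Finsupp.single (∅ : Finset Λ) (1 : ZMod 2)) from
        LinearMap.congr_fun h x
    refine wordChain_hom_ext fun w => ?_
    have h₀ : simplexBd Λ (labelChain ℓ (k + 1) (wordBd w)) = 0 := by
      rw [ih, ← chainBd_word, chainBd_chainBd, chainAug_chainBd, map_zero, zero_smul, add_zero]
    have h₁ : simplexBd Λ (Finsupp.single ∅ 1) = 0 := by simp [simplexBd]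
    simp only [LinearMap.comp_apply, labelChain_succ_word, simplexBd_simplexCone, h₀, h₁,
      map_add, map_smul, map_zero, add_zero, chainBd_word,
      LinearMap.add_apply, LinearMap.smulRight_apply, AlgHom.toLinearMap_apply]

lemma labelChain_word_mem {Λ : Type*} [DecidableEq Λ] (ℓ : List (V × V) → Λ) (k : ℕ)
    (w : List (Letter r)) : labelChain ℓ k (word w) ∈ Finsupp.supported (ZMod 2) (ZMod 2)
      {S : Finset Λ | S.card = wordDim w + 1 ∧ (S : Set Λ) ⊆ ℓ '' wordVerts w} := by
  induction k generalizing w with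
  | zero => exact zero_mem _
  | succ k ih =>
    rw [labelChain_succ_word]
    refine simplexCone_mem_supported (s := {S : Finset Λ | S.card = wordDim w ∧ (S : Set Λ) ⊆
      ℓ '' wordVerts w}) _ ?_ (add_mem ?_ ?_)
    · rintro S ⟨hS, hSw⟩ hv
      refine ⟨by rw [Finset.card_insert_of_notMem hv, hS], ?_⟩
      rw [Finset.coe_insert]
      exact Set.insert_subset ⟨_, wordBase_mem_wordVerts w, rfl⟩ hSw
    · suffices h : wordSpan (IsFace · w) ≤ (Finsupp.supported (ZMod 2) (ZMod 2) _).comap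
        (labelChain ℓ k) from h (wordBd_mem w)
      refine wordSpan_le fun w' hw' => ?_
      refine Finsupp.supported_mono ?_ (ih w')
      rintro S ⟨hS, hSw⟩
      exact ⟨hS.trans hw'.2.1, hSw.trans (Set.image_mono hw'.2.2)⟩
    · rw [chainAug_word]
      split_ifs with h
      · rw [one_smul]
        exact Finsupp.single_mem_supported _ _ (by simp [h])
      · simp

lemma simplexNeg_labelChain {ι : Type*} [DecidableEq ι] {ℓ : List (V × V) → ι × Bool}
    {p : List (Letter r) → Prop} (hp : ∀ w w', p w → IsFace w' w → p w')
    (hneg : ∀ w, p w → ∀ v ∈ wordVerts w, ℓ (v.map Prod.swap) = negLabel (ℓ v)) (k : ℕ)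
    {x : WordChain r} (hx : x ∈ wordSpan p) :
    labelChain ℓ k (chainSwap x) = simplexNeg ι (labelChain ℓ k x) := by
  induction k generalizing x with
  | zero => simp [labelChain]
  | succ k ih =>
    suffices h : wordSpan p ≤ LinearMap.eqLocus (labelChain ℓ (k + 1) ∘ₗ chainSwap.toLinearMap)
      (simplexNeg ι ∘ₗ labelChain ℓ (k + 1)) from h hx
    refine wordSpan_le fun w hw => ?_
    have h₀ : simplexNeg ι (Finsupp.single ∅ 1) = Finsupp.single ∅ 1 := by
      simp [simplexNeg, Finsupp.mapDomain_single]
    have h₁ : wordBd w ∈ wordSpan p := wordSpan_mono (hp w · hw) (wordBd_mem w)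
    rw [LinearMap.mem_eqLocus, LinearMap.comp_apply, LinearMap.comp_apply,
      AlgHom.toLinearMap_apply, labelChain_succ_word, simplexNeg_simplexCone, map_add, map_smul, h₀,
      ← ih h₁, ← hneg w hw _ (wordBase_mem_wordVerts w), chainSwap_word, labelChain_succ_word,
      wordBase_map_swap, ← chainSwap_word, chainAug_chainSwap, ← chainBd_word, ← chainBd_word,
      chainSwap_chainBd, chainSwap_word]

lemma noOpp_of_subset {ι : Type*} {ℓ : List (V × V) → ι × Bool} {w : List (Letter r)}
    (hopp : ∀ v ∈ wordVerts w, ∀ v' ∈ wordVerts w, ℓ v' ≠ negLabel (ℓ v))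
    {S : Finset (ι × Bool)} (hS : (S : Set (ι × Bool)) ⊆ ℓ '' wordVerts w) : NoOpp S := by
  intro a ha a' ha' haa
  obtain ⟨v, hv, rfl⟩ := hS ha
  obtain ⟨v', hv', rfl⟩ := hS ha'
  by_contra hne
  refine hopp v hv v' hv' (Prod.ext haa.symm ?_)
  have : (ℓ v).2 ≠ (ℓ v').2 := fun h => hne (Prod.ext haa h)
  simp only [negLabel]
  revert this
  cases (ℓ v).2 <;> cases (ℓ v').2 <;> simp

/-- `d'` is obtained from the equivariant chain `d` by filling half of its boundary, up to
chains in the subcomplex of words satisfying `p`. -/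
def FanStep (p : List (Letter r) → Prop) (d d' : WordChain r) : Prop :=
  ∃ b, d' = b + chainSwap b ∧ chainBd b + d ∈ wordSpan p

/-- The hypotheses on a labelling of the vertices of a subcomplex in Ky Fan's lemma. -/
structure IsFanLabelling {ι : Type*} (p : List (Letter r) → Prop) (ℓ : List (V × V) → ι × Bool) :
    Prop where
  face : ∀ w w', p w → IsFace w' w → p w'
  neg : ∀ w, p w → ∀ v ∈ wordVerts w, ℓ (v.map Prod.swap) = negLabel (ℓ v)
  opp : ∀ w, p w → ∀ v ∈ wordVerts w, ∀ v' ∈ wordVerts w, ℓ v' ≠ negLabel (ℓ v)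

namespace IsFanLabelling

variable {ι : Type*} [LinearOrder ι] {p : List (Letter r) → Prop} {ℓ : List (V × V) → ι × Bool}

lemma fanCochain_add_swap (h : IsFanLabelling p ℓ) (k : ℕ) {x : WordChain r}
    (hx : x ∈ wordSpan p) : fanCochain ι (labelChain ℓ (k + 1) (x + chainSwap x)) =
      fanCochain ι (labelChain ℓ k (chainBd x)) + chainAug x := by
  have hno : labelChain ℓ (k + 1) x ∈ Finsupp.supported (ZMod 2) (ZMod 2) {S | NoOpp S} := by
    suffices H : wordSpan p ≤ (Finsupp.supported (ZMod 2) (ZMod 2)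
      {S | NoOpp S}).comap (labelChain ℓ (k + 1)) from H hx
    refine wordSpan_le fun w hw => Finsupp.supported_mono ?_ (labelChain_word_mem ℓ (k + 1) w)
    exact fun S hS => noOpp_of_subset (h.opp w hw) hS.2
  rw [map_add, simplexNeg_labelChain h.face h.neg (k + 1) hx, map_add, fanCochain_add_neg hno,
    simplexBd_labelChain, map_add, map_smul]
  simp [fanCochain, altInd, Alternates]

lemma fanCochain_step (h : IsFanLabelling p ℓ) (k : ℕ) {d d' : WordChain r}
    (hd : chainSwap d = d) (hs : FanStep p d d') :
    fanCochain ι (labelChain ℓ (k + 1) (chainBd d')) =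
      fanCochain ι (labelChain ℓ k (chainBd d)) + chainAug d := by
  obtain ⟨b, rfl, hb⟩ := hs
  have key := h.fanCochain_add_swap k hb
  rw [map_add chainSwap, hd, add_add_add_comm, wordChain_add_self, add_zero, chainSwap_chainBd,
    ← map_add chainBd, map_add chainAug, chainAug_chainBd, zero_add, map_add chainBd _ d,
    chainBd_chainBd, zero_add] at key
  exact key

lemma fanCochain_transGen (h : IsFanLabelling p ℓ) {d₀ d : WordChain r}
    (hswap : chainSwap d₀ = d₀) (hbd : chainBd d₀ = 0) (haug : chainAug d₀ = 1)
    (hs : Relation.TransGen (FanStep p) d₀ d) :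
    ∃ k, fanCochain ι (labelChain ℓ k (chainBd d)) = 1 := by
  have key : ∀ {d}, Relation.TransGen (FanStep p) d₀ d → chainSwap d = d ∧ chainAug d = 0 := by
    intro d hd
    obtain ⟨e, -, b, rfl, -⟩ := (Relation.TransGen.tail'_iff).1 hd
    rw [map_add, chainSwap_chainSwap, map_add, chainAug_chainSwap, add_comm]
    exact ⟨rfl, CharTwo.add_self_eq_zero _⟩
  induction hs with
  | single hd =>
    refine ⟨1, ?_⟩
    rw [h.fanCochain_step 0 hswap hd, hbd, haug]
    simp
  | tail hd hs ih =>
    obtain ⟨k, hk⟩ := ih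
    refine ⟨k + 1, ?_⟩
    rw [h.fanCochain_step k (key hd).1 hs, hk, (key hd).2, add_zero]

lemma labelChain_eq_zero [Fintype ι] (h : IsFanLabelling p ℓ) (k : ℕ) {m : ℕ}
    (hm : Fintype.card ι ≤ m) {x : WordChain r}
    (hx : x ∈ wordSpan fun w => p w ∧ wordDim w = m) : labelChain ℓ k x = 0 := by
  suffices H : wordSpan (fun w => p w ∧ wordDim w = m) ≤ LinearMap.ker (labelChain ℓ k) from H hx
  refine wordSpan_le fun w hw => ?_
  have := labelChain_word_mem ℓ k w
  refine LinearMap.mem_ker.2 (Finsupp.support_eq_empty.1 ?_)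
  refine Finset.eq_empty_of_forall_notMem fun S hS' => ?_
  obtain ⟨hS, hSw⟩ := (Finsupp.mem_supported _ _).1 this hS'
  have hinj : NoOpp S := noOpp_of_subset (h.opp w hw.1) hSw
  have := Finset.card_image_of_injOn hinj
  have := Finset.card_le_univ (S.image Prod.fst)
  omega

/-- There is no labelling with fewer labels than the dimension when the obstruction class
does not vanish. -/
theorem false_of_transGen [Fintype ι] (h : IsFanLabelling p ℓ) {d₀ d a : WordChain r}
    (hswap : chainSwap d₀ = d₀) (hbd : chainBd d₀ = 0) (haug : chainAug d₀ = 1)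
    (hs : Relation.TransGen (FanStep p) d₀ d) {m : ℕ} (hm : Fintype.card ι ≤ m) (hm₀ : 0 < m)
    (ha : a ∈ wordSpan fun w => p w ∧ wordDim w = m) (hda : chainBd d = chainBd a) : False := by
  obtain ⟨k, hk⟩ := h.fanCochain_transGen hswap hbd haug hs
  have hap : a ∈ wordSpan p := wordSpan_mono (fun w hw => hw.1) ha
  have hε : chainAug a = 0 := by
    suffices H : wordSpan (fun w => p w ∧ wordDim w = m) ≤
      LinearMap.ker (chainAug (r := r)).toLinearMap from H ha
    refine wordSpan_le fun w hw => ?_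
    rw [LinearMap.mem_ker, AlgHom.toLinearMap_apply, chainAug_word, if_neg (by omega)]
  have key := h.fanCochain_add_swap k hap
  rw [← hda, hk, hε, map_add, simplexNeg_labelChain h.face h.neg _ hap,
    h.labelChain_eq_zero _ hm ha] at key
  simp at key

end IsFanLabelling

end Labelling

/-! ### The obstruction for products -/

section Products

variable {V : Type*} {r : V → V → Prop}

/-- The words of length `N` in the simplicial deleted power: at every vertex some pair of
coordinates is separated. -/
def IsSeparated (Sep : V → V → Prop) (N : ℕ) (w : List (Letter r)) : Prop :=
  w.length = N ∧ ∀ v ∈ wordVerts w, ∃ q ∈ v, Sep q.1 q.2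

variable {Sep : V → V → Prop}

lemma IsSeparated.face {N : ℕ} {w w' : List (Letter r)} (h : IsSeparated Sep N w)
    (hw : IsFace w' w) : IsSeparated Sep N w' :=
  ⟨hw.1.trans h.1, fun v hv => h.2 v (hw.2.2 hv)⟩

lemma IsSeparated.append_right {N M : ℕ} {l m : List (Letter r)} (h : IsSeparated Sep N l)
    (hm : m.length = M) : IsSeparated Sep (N + M) (l ++ m) := by
  refine ⟨by simp [h.1, hm], fun v hv => ?_⟩
  obtain ⟨v₁, h₁, v₂, -, rfl⟩ := mem_wordVerts_append.1 hv
  obtain ⟨q, hq, hs⟩ := h.2 v₁ h₁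
  exact ⟨q, List.mem_append_left _ hq, hs⟩

lemma IsSeparated.append_left {N M : ℕ} {l m : List (Letter r)} (h : IsSeparated Sep M m)
    (hl : l.length = N) : IsSeparated Sep (N + M) (l ++ m) := by
  refine ⟨by simp [h.1, hl], fun v hv => ?_⟩
  obtain ⟨v₁, -, v₂, h₂, rfl⟩ := mem_wordVerts_append.1 hv
  obtain ⟨q, hq, hs⟩ := h.2 v₂ h₂
  exact ⟨q, List.mem_append_right _ hq, hs⟩

lemma mul_mem_separated_right {N : ℕ} {x y : WordChain r} (hx : x ∈ wordSpan (IsSeparated Sep N))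
    (hy : y ∈ wordSpan (·.length = 1)) : x * y ∈ wordSpan (IsSeparated Sep (N + 1)) :=
  mul_mem_wordSpan (fun _ _ hl hm => hl.append_right hm) hx hy

lemma mul_mem_separated_left {N : ℕ} {x y : WordChain r} (hx : x ∈ wordSpan (·.length = N))
    (hy : y ∈ wordSpan (IsSeparated Sep 1)) : x * y ∈ wordSpan (IsSeparated Sep (N + 1)) :=
  mul_mem_wordSpan (fun _ _ hl hm => hm.append_left hl) hx hy

lemma wordDim_append (l m : List (Letter r)) : wordDim (l ++ m) = wordDim l + wordDim m := by
  simp [wordDim]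

/-- Chains witnessing that the deleted square of a graph has a nonzero van Kampen obstruction. -/
structure ObstructionData (Sep : V → V → Prop) (o u b η : WordChain r) : Prop where
  o_mem : o ∈ wordSpan (·.length = 1)
  swap_o : chainSwap o = o
  bd_o : chainBd o = 0
  aug_o : chainAug o = 1
  u_mem : u ∈ wordSpan (·.length = 1)
  bd_u : chainBd u + o ∈ wordSpan (IsSeparated Sep 1)
  b_mem : b ∈ wordSpan (·.length = 1)
  bd_b : chainBd b + (u + chainSwap u) ∈ wordSpan (IsSeparated Sep 1)
  top_mem : b + chainSwap b ∈ wordSpan fun w => w.length = 1 ∧ wordDim w = 2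
  η_mem : η ∈ wordSpan fun w => IsSeparated Sep 1 w ∧ wordDim w = 2
  bd_η : chainBd η = chainBd (b + chainSwap b)

lemma FanStep.mul_right {N : ℕ} {d d' o : WordChain r} (ho : o ∈ wordSpan (·.length = 1))
    (hs : chainSwap o = o) (hb : chainBd o = 0) (h : FanStep (IsSeparated Sep N) d d') :
    FanStep (IsSeparated Sep (N + 1)) (d * o) (d' * o) := by
  obtain ⟨b, rfl, h⟩ := h
  refine ⟨b * o, by rw [map_mul, hs, add_mul], ?_⟩
  rw [chainBd_mul, hb, mul_zero, add_zero, ← add_mul]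
  exact mul_mem_separated_right h ho

lemma FanStep.mul_left {N : ℕ} {d x y z : WordChain r} (hd : d ∈ wordSpan (·.length = N))
    (hs : chainSwap d = d) (hb : chainBd d ∈ wordSpan (IsSeparated Sep N))
    (hy : y ∈ wordSpan (·.length = 1)) (hxy : chainBd y + x ∈ wordSpan (IsSeparated Sep 1))
    (hz : z = y + chainSwap y) : FanStep (IsSeparated Sep (N + 1)) (d * x) (d * z) := by
  refine ⟨d * y, by rw [map_mul, hs, hz, mul_add], ?_⟩
  rw [chainBd_mul, add_assoc, ← mul_add]
  exact add_mem (mul_mem_separated_right hb hy) (mul_mem_separated_left hd hxy)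

namespace ObstructionData

variable {o u b η : WordChain r}

lemma pow_mem (h : ObstructionData Sep o u b η) (N : ℕ) :
    (b + chainSwap b) ^ N ∈ wordSpan (·.length = N) := by
  induction N with
  | zero => exact word_mem_wordSpan (l := []) rfl
  | succ N ih =>
    rw [pow_succ]
    exact mul_mem_wordSpan (fun l m hl hm => by simp [hl, hm.1]) ih h.top_mem

lemma bd_pow_mem (h : ObstructionData Sep o u b η) (N : ℕ) :
    chainBd ((b + chainSwap b) ^ N) ∈ wordSpan (IsSeparated Sep N) := by
  induction N with
  | zero => rw [pow_zero, chainBd_one]; exact zero_mem _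
  | succ N ih =>
    have hη : chainBd (b + chainSwap b) ∈ wordSpan (IsSeparated Sep 1) := by
      rw [← h.bd_η]
      exact chainBd_mem (fun _ _ => IsSeparated.face) (wordSpan_mono (fun _ hw => hw.1) h.η_mem)
    rw [pow_succ, chainBd_mul]
    exact add_mem (mul_mem_separated_right ih (wordSpan_mono (fun _ hw => hw.1) h.top_mem))
      (mul_mem_separated_left (h.pow_mem N) hη)

lemma swap_top : chainSwap (b + chainSwap b) = b + chainSwap b := by
  rw [map_add, chainSwap_chainSwap, add_comm]

lemma transGen_mul (h : ObstructionData Sep o u b η) (N : ℕ) :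
    Relation.TransGen (FanStep (IsSeparated Sep (N + 1))) ((b + chainSwap b) ^ N * o)
      ((b + chainSwap b) ^ (N + 1)) := by
  have hs : chainSwap ((b + chainSwap b) ^ N) = (b + chainSwap b) ^ N := by
    rw [map_pow, swap_top]
  rw [pow_succ]
  exact .tail (.single (FanStep.mul_left (h.pow_mem N) hs (h.bd_pow_mem N) h.u_mem h.bd_u rfl))
    (FanStep.mul_left (h.pow_mem N) hs (h.bd_pow_mem N) h.b_mem h.bd_b rfl)

lemma reflTransGen_pow (h : ObstructionData Sep o u b η) (N : ℕ) :
    Relation.ReflTransGen (FanStep (IsSeparated Sep N)) (o ^ N) ((b + chainSwap b) ^ N) := by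
  induction N with
  | zero => rw [pow_zero, pow_zero]
  | succ N ih =>
    have := ih.lift (· * o) fun _ _ => FanStep.mul_right h.o_mem h.swap_o h.bd_o
    rw [pow_succ o]
    exact this.trans (h.transGen_mul N).to_reflTransGen

lemma transGen_pow (h : ObstructionData Sep o u b η) (N : ℕ) :
    Relation.TransGen (FanStep (IsSeparated Sep (N + 1))) (o ^ (N + 1))
      ((b + chainSwap b) ^ (N + 1)) := by
  have := (h.reflTransGen_pow N).lift (· * o) fun _ _ => FanStep.mul_right h.o_mem h.swap_o h.bd_o
  rw [pow_succ o]
  exact .trans_right this (h.transGen_mul N)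

lemma exists_filling (h : ObstructionData Sep o u b η) (N : ℕ) :
    ∃ a ∈ wordSpan fun w => IsSeparated Sep N w ∧ wordDim w = 2 * N,
      chainBd ((b + chainSwap b) ^ N) = chainBd a := by
  set δ := b + chainSwap b with hδ
  have hA : chainBd (δ + η) = 0 := by rw [map_add, h.bd_η, wordChain_add_self]
  have hbd : chainBd ((δ + η) ^ N) = 0 := by
    induction N with
    | zero => rw [pow_zero, chainBd_one]
    | succ N ih => rw [pow_succ, chainBd_mul, ih, hA, zero_mul, mul_zero, add_zero]
  have hA₁ : δ + η ∈ wordSpan fun w => w.length = 1 ∧ wordDim w = 2 :=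
    add_mem h.top_mem (wordSpan_mono (fun _ hw => ⟨hw.1.1, hw.2⟩) h.η_mem)
  have hAN : ∀ N, (δ + η) ^ N ∈ wordSpan fun w => w.length = N ∧ wordDim w = 2 * N := by
    intro N
    induction N with
    | zero => exact word_mem_wordSpan (l := []) ⟨rfl, rfl⟩
    | succ N ih =>
      rw [pow_succ]
      refine mul_mem_wordSpan (fun l m hl hm => ⟨by simp [hl.1, hm.1], ?_⟩) ih hA₁
      rw [wordDim_append, hl.2, hm.2, mul_add]
  refine ⟨(δ + η) ^ N + δ ^ N, ?_, by rw [map_add, hbd, zero_add]⟩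
  clear hbd
  induction N with
  | zero => rw [pow_zero, pow_zero, wordChain_add_self]; exact zero_mem _
  | succ N ih =>
    have : (δ + η) ^ (N + 1) + δ ^ (N + 1) = ((δ + η) ^ N + δ ^ N) * δ + (δ + η) ^ N * η := by
      rw [pow_succ, pow_succ]
      noncomm_ring
    rw [this]
    refine add_mem (mul_mem_wordSpan (fun l m hl hm => ⟨hl.1.append_right hm.1, ?_⟩) ih h.top_mem)
      (mul_mem_wordSpan (fun l m hl hm => ⟨hm.1.append_left hl.1, ?_⟩) (hAN N) h.η_mem) <;>
    rw [wordDim_append, hl.2, hm.2, mul_add]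

/-- A graph with nonzero van Kampen obstruction has no equivariant labelling of the deleted square
of its `N`-th power by `2 * N` signed labels. -/
theorem not_isFanLabelling (h : ObstructionData Sep o u b η) {N : ℕ} (hN : 0 < N) {ι : Type*}
    [LinearOrder ι] [Fintype ι] (hι : Fintype.card ι = 2 * N) (ℓ : List (V × V) → ι × Bool)
    (hneg : ∀ w : List (Letter r), IsSeparated Sep N w → ∀ v ∈ wordVerts w,
      ℓ (v.map Prod.swap) = negLabel (ℓ v))
    (hopp : ∀ w : List (Letter r), IsSeparated Sep N w → ∀ v ∈ wordVerts w, ∀ v' ∈ wordVerts w,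
      ℓ v' ≠ negLabel (ℓ v)) : False := by
  obtain ⟨N, rfl⟩ := Nat.exists_eq_add_of_lt hN
  rw [zero_add] at *
  have hfan : IsFanLabelling (IsSeparated (r := r) Sep (N + 1)) ℓ :=
    ⟨fun _ _ => IsSeparated.face, hneg, hopp⟩
  have hbd : ∀ N, chainBd (o ^ N) = 0 := by
    intro N
    induction N with
    | zero => rw [pow_zero, chainBd_one]
    | succ N ih => rw [pow_succ, chainBd_mul, ih, h.bd_o, zero_mul, mul_zero, add_zero]
  obtain ⟨a, ha, hda⟩ := h.exists_filling (N + 1)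
  exact hfan.false_of_transGen (by rw [map_pow, h.swap_o]) (hbd _)
    (by rw [map_pow, h.aug_o, one_pow]) (h.transGen_pow N) hι.le (by omega) ha hda

end ObstructionData

end Products

/-! ### The obstruction for `K₃,₃` -/

section BipartiteObstruction

variable {V : Type*} {r : V → V → Prop}

/-- The chains of a graph contained in a set of vertices and of given dimension. -/
def chainsIn (r : V → V → Prop) (n : ℕ) (s : Set V) : Submodule (ZMod 2) (Cell r →₀ ZMod 2) :=
  Finsupp.supported (ZMod 2) (ZMod 2) {c | c.dim = n ∧ c.verts ⊆ s}

/-- A topological `K₃,₃` in the graph with adjacency `r`, given by mod 2 chains `E i j` joining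
`a i` to `b j` inside of `Seg i j`, where disjoint edges are separated. -/
structure BipartiteChains (Sep : V → V → Prop) (Seg : Fin 3 → Fin 3 → Set V) (a b : Fin 3 → V)
    (E : Fin 3 → Fin 3 → (Cell r →₀ ZMod 2)) : Prop where
  a_mem : ∀ i j, a i ∈ Seg i j
  b_mem : ∀ i j, b j ∈ Seg i j
  E_mem : ∀ i j, E i j ∈ chainsIn r 1 (Seg i j)
  bd_E : ∀ i j, cellBd (E i j) = Finsupp.single (.inl (a i)) 1 + Finsupp.single (.inl (b j)) 1
  sep : ∀ {i i' j j'}, i ≠ i' → j ≠ j' → ∀ {x y}, x ∈ Seg i j → y ∈ Seg i' j' → Sep x y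

lemma single_mem_chainsIn {x : V} {s : Set V} (hx : x ∈ s) :
    Finsupp.single (.inl x) 1 ∈ chainsIn r 0 s :=
  Finsupp.single_mem_supported _ _ ⟨rfl, by simpa [Cell.verts] using hx⟩

lemma cross_mem_length {n m : ℕ} {s t : Set V} {x y : Cell r →₀ ZMod 2} (hx : x ∈ chainsIn r n s)
    (hy : y ∈ chainsIn r m t) :
    cross x y ∈ wordSpan fun w => w.length = 1 ∧ wordDim w = n + m :=
  cross_mem_wordSpan (fun c hc c' hc' => ⟨rfl, by simp [wordDim, hc.1, hc'.1]⟩) hx hy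

namespace BipartiteChains

variable {Sep : V → V → Prop} {Seg : Fin 3 → Fin 3 → Set V} {a b : Fin 3 → V}
  {E : Fin 3 → Fin 3 → (Cell r →₀ ZMod 2)}

lemma cross_mem (h : BipartiteChains Sep Seg a b E) {n m : ℕ} {i i' j j' : Fin 3} (hi : i ≠ i')
    (hj : j ≠ j') {x y : Cell r →₀ ZMod 2} (hx : x ∈ chainsIn r n (Seg i j))
    (hy : y ∈ chainsIn r m (Seg i' j')) :
    cross x y ∈ wordSpan fun w => IsSeparated Sep 1 w ∧ wordDim w = n + m := by
  refine cross_mem_wordSpan (fun c hc c' hc' => ⟨⟨rfl, fun v hv => ?_⟩, ?_⟩) hx hy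
  · cases hv with
    | cons hq _ => exact ⟨_, List.mem_cons_self, h.sep hi hj (hc.2 hq.1) (hc'.2 hq.2)⟩
  · simp [wordDim, hc.1, hc'.1]

/-- The part of the deleted square over the disjoint pairs of edges ending in `b i` and `b j`,
other than the pairs meeting in `a 0`. -/
def filling (E : Fin 3 → Fin 3 → (Cell r →₀ ZMod 2)) (i j : Fin 3) : WordChain r :=
  cross (E 0 i) (E 1 j) + cross (E 2 i) (E 0 j) + cross (E 2 i) (E 1 j)

lemma filling_mem (h : BipartiteChains Sep Seg a b E) {i j : Fin 3} (hij : i ≠ j) :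
    filling E i j ∈ wordSpan fun w => IsSeparated Sep 1 w ∧ wordDim w = 2 := by
  have key : ∀ {k l : Fin 3}, k ≠ l → cross (E k i) (E l j) ∈
      wordSpan fun w => IsSeparated Sep 1 w ∧ wordDim w = 2 := fun hkl =>
    h.cross_mem (n := 1) (m := 1) hkl hij (h.E_mem _ i) (h.E_mem _ j)
  unfold filling
  exact Submodule.add_mem _ (Submodule.add_mem _ (key (by decide)) (key (by decide)))
    (key (by decide))

lemma two_zsmul_eq_zero {M : Type*} [AddCommGroup M] (h : ∀ x : M, x + x = 0) (x : M) :
    (2 : ℤ) • x = 0 := by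
  rw [two_zsmul, h]

lemma eq_of_add_eq_zero {x y : WordChain r} (h : x + y = 0) : x = y := by
  rw [← add_zero x, ← wordChain_add_self y, ← add_assoc, h, zero_add]

lemma filling_eq (i j : Fin 3) : filling E i j =
    cross (E 0 i + E 2 i) (E 0 j + E 1 j) + cross (E 0 i) (E 0 j) := by
  refine eq_of_add_eq_zero ?_
  simp only [filling, map_add, LinearMap.add_apply]
  generalize cross (E 0 i) (E 0 j) = x₀₀, cross (E 0 i) (E 1 j) = x₀₁,
    cross (E 2 i) (E 0 j) = x₂₀, cross (E 2 i) (E 1 j) = x₂₁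
  abel_nf
  simp only [two_zsmul_eq_zero wordChain_add_self, add_zero]

lemma bd_cross (h : BipartiteChains Sep Seg a b E) (i j : Fin 3) :
    chainBd (cross (E 0 i + E 2 i) (E 0 j + E 1 j)) =
      cross (Finsupp.single (.inl (a 0)) 1 + Finsupp.single (.inl (a 2)) 1) (E 0 j + E 1 j) +
      cross (E 0 i + E 2 i) (Finsupp.single (.inl (a 0)) 1 + Finsupp.single (.inl (a 1)) 1) := by
  have key : ∀ x y z : Cell r →₀ ZMod 2, x + y + (z + y) = x + z := fun x y z => by
    rw [add_add_add_comm, ← two_smul (ZMod 2) y, show (2 : ZMod 2) = 0 from rfl, zero_smul,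
      add_zero]
  rw [chainBd_cross, map_add cellBd, map_add cellBd, h.bd_E, h.bd_E, h.bd_E, h.bd_E, key, key]

lemma bd_filling (h : BipartiteChains Sep Seg a b E) :
    chainBd (filling E 0 1 + filling E 0 2 + filling E 1 0 + filling E 1 2 + filling E 2 0 +
      filling E 2 1) =
    chainBd (cross (E 0 0) (E 0 2) + cross (E 0 1) (E 0 0) + cross (E 0 1) (E 0 2) +
      chainSwap (cross (E 0 0) (E 0 2) + cross (E 0 1) (E 0 0) + cross (E 0 1) (E 0 2))) := by
  refine eq_of_add_eq_zero ?_
  simp only [filling_eq, map_add chainSwap, chainSwap_cross, map_add chainBd, h.bd_cross]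
  generalize cross (_ + _) (E 0 0 + E 1 0) = x₀
  generalize cross (_ + _) (E 0 1 + E 1 1) = x₁
  generalize cross (_ + _) (E 0 2 + E 1 2) = x₂
  generalize cross (E 0 0 + E 2 0) _ = y₀
  generalize cross (E 0 1 + E 2 1) _ = y₁
  generalize cross (E 0 2 + E 2 2) _ = y₂
  generalize chainBd (cross (E 0 0) (E 0 1)) = z₀₁, chainBd (cross (E 0 1) (E 0 0)) = z₁₀,
    chainBd (cross (E 0 0) (E 0 2)) = z₀₂, chainBd (cross (E 0 2) (E 0 0)) = z₂₀,
    chainBd (cross (E 0 1) (E 0 2)) = z₁₂, chainBd (cross (E 0 2) (E 0 1)) = z₂₁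
  abel_nf
  simp only [two_zsmul_eq_zero wordChain_add_self, add_zero]

lemma bd_half (h : BipartiteChains Sep Seg a b E) :
    chainBd (cross (E 0 0) (E 0 2) + cross (E 0 1) (E 0 0) + cross (E 0 1) (E 0 2)) +
      (cross (Finsupp.single (.inl (a 0)) 1) (E 0 0) +
        chainSwap (cross (Finsupp.single (.inl (a 0)) 1) (E 0 0))) =
    cross (Finsupp.single (.inl (b 0)) 1) (E 0 2) +
      cross (E 0 0) (Finsupp.single (.inl (b 2)) 1) +
      cross (Finsupp.single (.inl (b 1)) 1) (E 0 0) +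
      cross (E 0 1) (Finsupp.single (.inl (b 0)) 1) +
      cross (Finsupp.single (.inl (b 1)) 1) (E 0 2) +
      cross (E 0 1) (Finsupp.single (.inl (b 2)) 1) := by
  refine eq_of_add_eq_zero ?_
  simp only [map_add, chainBd_cross, h.bd_E, LinearMap.add_apply, chainSwap_cross]
  abel_nf
  simp only [two_zsmul_eq_zero wordChain_add_self, add_zero]

theorem obstructionData (h : BipartiteChains Sep Seg a b E) :
    ObstructionData Sep
      (cross (Finsupp.single (.inl (a 0)) 1) (Finsupp.single (.inl (a 0)) 1))
      (cross (Finsupp.single (.inl (a 0)) 1) (E 0 0))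
      (cross (E 0 0) (E 0 2) + cross (E 0 1) (E 0 0) + cross (E 0 1) (E 0 2))
      (filling E 0 1 + filling E 0 2 + filling E 1 0 + filling E 1 2 + filling E 2 0 +
        filling E 2 1) := by
  have hA : ∀ i j, Finsupp.single (.inl (a i)) 1 ∈ chainsIn r 0 (Seg i j) :=
    fun i j => single_mem_chainsIn (h.a_mem i j)
  have hB : ∀ i j, Finsupp.single (.inl (b j)) 1 ∈ chainsIn r 0 (Seg i j) :=
    fun i j => single_mem_chainsIn (h.b_mem i j)
  have hvert : ∀ x : V, cellBd (Finsupp.single (.inl x : Cell r) 1) = 0 := fun x => by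
    simp [cellBd, Cell.bd]
  have good : ∀ {n m : ℕ} {i i' j j' : Fin 3}, i ≠ i' → j ≠ j' → ∀ {x y : Cell r →₀ ZMod 2},
      x ∈ chainsIn r n (Seg i j) → y ∈ chainsIn r m (Seg i' j') →
      cross x y ∈ wordSpan (IsSeparated Sep 1) := fun hi hj _ _ hx hy =>
    wordSpan_mono (fun w hw => hw.1) (h.cross_mem hi hj hx hy)
  have len : ∀ {n : ℕ} {x : WordChain r},
      (x ∈ wordSpan fun w => w.length = 1 ∧ wordDim w = n) → x ∈ wordSpan (·.length = 1) :=
    fun hx => wordSpan_mono (fun w hw => hw.1) hx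
  have hEE : ∀ i j, cross (E 0 i) (E 0 j) ∈ wordSpan fun w => w.length = 1 ∧ wordDim w = 2 :=
    fun i j => cross_mem_length (n := 1) (m := 1) (h.E_mem 0 i) (h.E_mem 0 j)
  constructor
  case o_mem => exact len (cross_mem_length (n := 0) (m := 0) (hA 0 0) (hA 0 0))
  case swap_o => rw [chainSwap_cross]
  case bd_o => rw [chainBd_cross, hvert, map_zero, map_zero, LinearMap.zero_apply, add_zero]
  case aug_o => simp [cross_single_single, chainAug_word, wordDim, Cell.dim]
  case u_mem => exact len (cross_mem_length (n := 0) (m := 1) (hA 0 0) (h.E_mem 0 0))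
  case bd_u =>
    rw [chainBd_cross, hvert, map_zero, LinearMap.zero_apply, zero_add, h.bd_E, map_add,
      add_right_comm, wordChain_add_self, zero_add]
    exact good (i := 0) (i' := 1) (j := 1) (j' := 0) (by decide) (by decide) (hA _ _) (hB _ _)
  case b_mem => exact len (add_mem (add_mem (hEE 0 2) (hEE 1 0)) (hEE 1 2))
  case bd_b =>
    rw [h.bd_half]
    have hl : ∀ {i j}, i ≠ j → cross (Finsupp.single (.inl (b i)) 1) (E 0 j) ∈
        wordSpan (IsSeparated Sep 1) := fun hij =>
      good (i := 1) (i' := 0) (by decide) hij (hB _ _) (h.E_mem _ _)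
    have hr : ∀ {i j}, i ≠ j → cross (E 0 i) (Finsupp.single (.inl (b j)) 1) ∈
        wordSpan (IsSeparated Sep 1) := fun hij =>
      good (i := 0) (i' := 1) (by decide) hij (h.E_mem _ _) (hB _ _)
    exact add_mem (add_mem (add_mem (add_mem (add_mem (hl (by decide)) (hr (by decide)))
      (hl (by decide))) (hr (by decide))) (hl (by decide))) (hr (by decide))
  case top_mem =>
    simp only [map_add, chainSwap_cross]
    exact add_mem (add_mem (add_mem (hEE 0 2) (hEE 1 0)) (hEE 1 2))
      (add_mem (add_mem (hEE 2 0) (hEE 0 1)) (hEE 2 1))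
  case η_mem =>
    exact add_mem (add_mem (add_mem (add_mem (add_mem (h.filling_mem (by decide))
      (h.filling_mem (by decide))) (h.filling_mem (by decide))) (h.filling_mem (by decide)))
      (h.filling_mem (by decide))) (h.filling_mem (by decide))
  case bd_η => exact h.bd_filling

end BipartiteChains

end BipartiteObstruction

/-! ### Powers of spaces containing `K₃,₃` -/

lemma exists_pathChain {X : Type*} [PseudoMetricSpace X] {a b : X} (γ : Path a b) {ε : ℝ}
    (hε : 0 < ε) : ∃ E ∈ chainsIn (fun x y : X => dist x y < ε) 1 (Set.range γ),
      cellBd E = Finsupp.single (.inl a) 1 + Finsupp.single (.inl b) 1 := by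
  have huc : UniformContinuous γ.extend :=
    (CompactSpace.uniformContinuous_of_continuous γ.continuous).comp
      (LipschitzWith.projIcc zero_le_one).uniformContinuous
  obtain ⟨δ, hδ, hγ⟩ := Metric.uniformContinuous_iff.1 huc ε hε
  obtain ⟨m, hm⟩ := exists_nat_one_div_lt hδ
  have step : ∀ n : ℕ, dist (γ.extend (n / (m + 1))) (γ.extend ((n + 1) / (m + 1))) < ε := by
    refine fun n => hγ ?_
    rw [dist_comm, Real.dist_eq, add_div, add_sub_cancel_left, abs_of_pos (by positivity)]
    exact hm
  have hmem : ∀ t, γ.extend t ∈ Set.range γ := fun t => ⟨_, rfl⟩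
  have key : ∀ n : ℕ, ∃ E ∈ chainsIn (fun x y : X => dist x y < ε) 1 (Set.range γ),
      cellBd E = Finsupp.single (.inl a) 1 +
        Finsupp.single (.inl (γ.extend (n / (m + 1)))) 1 := by
    intro n
    induction n with
    | zero =>
      refine ⟨0, zero_mem _, ?_⟩
      rw [Nat.cast_zero, zero_div, γ.extend_zero, ← Finsupp.single_add,
        CharTwo.add_self_eq_zero, Finsupp.single_zero, map_zero]
    | succ n ih =>
      obtain ⟨E, hE, hbd⟩ := ih
      refine ⟨E + Finsupp.single (.inr ⟨(_, _), step n⟩) 1, add_mem hE ?_, ?_⟩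
      · refine Finsupp.single_mem_supported _ _ ⟨rfl, ?_⟩
        exact Set.insert_subset (hmem _) (Set.singleton_subset_iff.2 (hmem _))
      · rw [map_add, hbd, cellBd, Finsupp.linearCombination_single, one_smul, Cell.bd, add_assoc,
          ← add_assoc (Finsupp.single _ _) (Finsupp.single _ _) (Finsupp.single _ _),
          ← Finsupp.single_add, CharTwo.add_self_eq_zero, Finsupp.single_zero, zero_add,
          Nat.cast_succ]
  obtain ⟨E, hE, hbd⟩ := key (m + 1)
  refine ⟨E, hE, ?_⟩
  rw [hbd, Nat.cast_succ, div_self (by positivity), γ.extend_one]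

/-- The pair of tuples described by a list of pairs. -/
def listPair {X : Type*} (x₀ : X) (N : ℕ) (v : List (X × X)) : (Fin N → X) × (Fin N → X) :=
  (fun i => (v.getD i (x₀, x₀)).1, fun i => (v.getD i (x₀, x₀)).2)

lemma listPair_map_swap {X : Type*} (x₀ : X) (N : ℕ) (v : List (X × X)) :
    listPair x₀ N (v.map Prod.swap) = (listPair x₀ N v).swap := by
  have : ∀ i, (v.map Prod.swap).getD i (x₀, x₀) = (v.getD i (x₀, x₀)).swap :=
    fun i => List.getD_map v (x₀, x₀) Prod.swap
  exact Prod.ext (funext fun i => congrArg Prod.fst (this i))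
    (funext fun i => congrArg Prod.snd (this i))

lemma dist_listPair_lt {X : Type*} [PseudoMetricSpace X] (x₀ : X) (N : ℕ) {ε : ℝ} (hε : 0 < ε)
    {w : List (Letter fun x y : X => dist x y < ε)} {v v' : List (X × X)} (hv : v ∈ wordVerts w)
    (hv' : v' ∈ wordVerts w) : dist (listPair x₀ N v) (listPair x₀ N v') < ε := by
  have hcell : ∀ {c : Cell fun x y : X => dist x y < ε} {x y}, x ∈ c.verts → y ∈ c.verts →
      dist x y < ε := by
    rintro (z | p) x y hx hy
    · obtain rfl : x = z := hx
      obtain rfl : y = x := hy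
      rwa [dist_self]
    · have := p.2
      rcases hx with rfl | rfl <;> rcases hy with rfl | rfl
      · rwa [dist_self]
      · exact this
      · rwa [dist_comm]
      · rwa [dist_self]
  have key : ∀ i, dist (v.getD i (x₀, x₀)).1 (v'.getD i (x₀, x₀)).1 < ε ∧
      dist (v.getD i (x₀, x₀)).2 (v'.getD i (x₀, x₀)).2 < ε := by
    intro i
    induction hv generalizing v' i with
    | nil =>
      cases hv'
      simpa
    | cons h _ ih =>
      cases hv' with
      | cons h' ht =>
        cases i with
        | zero => exact ⟨hcell h.1 h'.1, hcell h.2 h'.2⟩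
        | succ i => exact ih ht i
  rw [Prod.dist_eq, max_lt_iff, dist_pi_lt_iff hε, dist_pi_lt_iff hε]
  exact ⟨fun i => (key i).1, fun i => (key i).2⟩

/-- A continuous injection into `ℝ^ι` induces a labelling of fine subdivisions. -/
lemma exists_label {X : Type*} [MetricSpace X] [CompactSpace X] [Nonempty X]
    {Sep : X → X → Prop} (hcl : IsClosed {p : X × X | Sep p.1 p.2}) (hirr : ∀ x, ¬ Sep x x)
    {N : ℕ} {ι : Type*} [Fintype ι] [Nonempty ι] {f : (Fin N → X) → ι → ℝ} (hf : Continuous f)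
    (hinj : Function.Injective f) : ∃ ε > 0, ∃ ℓ : List (X × X) → ι × Bool,
      ∀ w : List (Letter fun x y : X => dist x y < ε), IsSeparated Sep N w →
        ∀ v ∈ wordVerts w, ℓ (v.map Prod.swap) = negLabel (ℓ v) ∧
          ∀ v' ∈ wordVerts w, ℓ v' ≠ negLabel (ℓ v) := by
  obtain ⟨x₀⟩ := ‹Nonempty X›
  set F : (Fin N → X) × (Fin N → X) → ι → ℝ := fun p => f p.1 - f p.2 with hF
  have hFc : Continuous F := by fun_prop
  have hD : IsCompact {p : (Fin N → X) × (Fin N → X) | ∃ i, Sep (p.1 i) (p.2 i)} := by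
    refine IsClosed.isCompact ?_
    simp only [Set.ofPred_exists]
    refine isClosed_iUnion_of_finite fun i => ?_
    exact hcl.preimage (f := fun p : (Fin N → X) × (Fin N → X) => (p.1 i, p.2 i)) (by fun_prop)
  obtain ⟨c, hc, hcF⟩ := hD.exists_forall_le' (f := fun p => ‖F p‖) (a := 0)
    hFc.norm.continuousOn (by
      rintro p ⟨i, hi⟩
      refine norm_pos_iff.2 (sub_ne_zero.2 fun h => ?_)
      rw [hinj h] at hi
      exact hirr _ hi)
  obtain ⟨ε, hε, hεF⟩ := Metric.uniformContinuous_iff.1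
    (CompactSpace.uniformContinuous_of_continuous hFc) c hc
  set G : List (X × X) → ι → ℝ := fun v => F (listPair x₀ N v) with hG
  set idx : List (X × X) → ι := fun v => Classical.epsilon fun i => c ≤ |G v i| with hidx
  have hGswap : ∀ v, G (v.map Prod.swap) = -G v := fun v => by
    simp [hG, hF, listPair_map_swap]
  have hidx_swap : ∀ v, idx (v.map Prod.swap) = idx v := fun v => by
    simp [hidx, hGswap]
  have hidx_le : ∀ w : List (Letter fun x y : X => dist x y < ε), IsSeparated Sep N w →
      ∀ v ∈ wordVerts w, c ≤ |G v (idx v)| := by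
    intro w hw v hv
    refine Classical.epsilon_spec (p := fun i => c ≤ |G v i|) ?_
    obtain ⟨q, hq, hs⟩ := hw.2 v hv
    obtain ⟨i, hi, rfl⟩ := List.getElem_of_mem hq
    have hlen : v.length = N := (List.Forall₂.length_eq hv).trans hw.1
    have := hcF (listPair x₀ N v) ⟨⟨i, hlen ▸ hi⟩, by simpa [listPair, hi] using hs⟩
    by_contra! hlt
    exact this.not_gt ((pi_norm_lt_iff hc).2 hlt)
  refine ⟨ε, hε, fun v => (idx v, decide (0 < G v (idx v))), fun w hw v hv => ⟨?_, ?_⟩⟩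
  · have h := hidx_le w hw v hv
    simp only [negLabel, hidx_swap, hGswap, Prod.mk.injEq, true_and, Pi.neg_apply]
    rcases lt_or_ge 0 (G v (idx v)) with h₀ | h₀
    · simp [h₀, h₀.le]
    · have : G v (idx v) ≠ 0 := fun h' => by rw [h', abs_zero] at h; exact h.not_gt hc
      simp [h₀, lt_of_le_of_ne h₀ this]
  · intro v' hv' heq
    have h := hidx_le w hw v hv
    have h' := hidx_le w hw v' hv'
    have hlt : dist (G v) (G v') < c := hεF (dist_listPair_lt x₀ N hε hv hv')
    have hi := (dist_pi_lt_iff hc).1 hlt (idx v)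
    simp only [negLabel, Prod.mk.injEq] at heq
    rw [heq.1] at h' heq
    rw [Real.dist_eq, abs_lt] at hi
    rcases lt_or_ge 0 (G v (idx v)) with h₀ | h₀
    · have h₁ : G v' (idx v) ≤ 0 := by simpa [h₀] using heq.2
      rw [abs_of_pos h₀] at h
      linarith
    · have h₁ : 0 < G v' (idx v) := by simpa [h₀.not_gt] using heq.2
      rw [abs_of_nonpos h₀] at h
      linarith

/-- If a compact metric space contains a `K₃,₃` formed by paths, with disjoint paths separated by
a closed irreflexive relation, then its `N`-th power does not embed into `ℝ^(2 * N)`. -/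
theorem not_injective_of_paths {X : Type*} [MetricSpace X] [CompactSpace X] {Sep : X → X → Prop}
    (hcl : IsClosed {p : X × X | Sep p.1 p.2}) (hirr : ∀ x, ¬ Sep x x) {a b : Fin 3 → X}
    (γ : ∀ i j, Path (a i) (b j))
    (hsep : ∀ {i i' j j'}, i ≠ i' → j ≠ j' → ∀ s t, Sep (γ i j s) (γ i' j' t)) {N : ℕ}
    (hN : 0 < N) {f : (Fin N → X) → Fin (2 * N) → ℝ} (hf : Continuous f) :
    ¬ Function.Injective f := by
  intro hinj
  have : Nonempty X := ⟨a 0⟩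
  have : Nonempty (Fin (2 * N)) := ⟨⟨0, by omega⟩⟩
  obtain ⟨ε, hε, ℓ, hℓ⟩ := exists_label hcl hirr hf hinj
  choose E hE hbd using fun i j => exists_pathChain (γ i j) hε
  have hK : BipartiteChains Sep (fun i j => Set.range (γ i j)) a b E := {
    a_mem := fun i j => ⟨0, (γ i j).source⟩
    b_mem := fun i j => ⟨1, (γ i j).target⟩
    E_mem := hE
    bd_E := hbd
    sep := by
      rintro i i' j j' hi hj _ _ ⟨s, rfl⟩ ⟨t, rfl⟩
      exact hsep hi hj s t }
  exact hK.obstructionData.not_isFanLabelling hN (Fintype.card_fin _) ℓ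
    (fun w hw v hv => (hℓ w hw v hv).1) (fun w hw v hv => (hℓ w hw v hv).2)

/-! ### The realization of `K₃,₃` -/

lemma isCompact_graphRealization {V : Type*} [Finite V] [DecidableEq V] (G : SimpleGraph V) :
    IsCompact (graphRealization G) := by
  refine isCompact_iUnion fun p => ?_
  rw [segment_eq_image_lineMap]
  exact isCompact_Icc.image AffineMap.lineMap_continuous

lemma sum_eq_one_of_mem_graphRealization {V : Type*} [Fintype V] [DecidableEq V]
    {G : SimpleGraph V} {x : V → ℝ} (hx : x ∈ graphRealization G) : ∑ v, x v = 1 := by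
  obtain ⟨p, s, t, -, -, hst, rfl⟩ := Set.mem_iUnion.1 hx
  simp [vert, Finset.sum_add_distrib, hst]

/-- The edge joining two adjacent vertices. -/
def edgePath {V : Type*} [DecidableEq V] {G : SimpleGraph V} {v w : V} (h : G.Adj v w)
    {x y : graphRealization G} (hx : x.1 = vert v) (hy : y.1 = vert w) : Path x y where
  toFun t := ⟨AffineMap.lineMap (vert v) (vert w) (t : ℝ), Set.mem_iUnion.2
    ⟨⟨(v, w), h⟩, by rw [segment_eq_image_lineMap]; exact ⟨t, t.2, rfl⟩⟩⟩
  continuous_toFun :=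
    (AffineMap.lineMap_continuous.comp continuous_subtype_val).subtype_mk _
  source' := Subtype.ext (by simp [hx])
  target' := Subtype.ext (by simp [hy])

lemma edgePath_apply {V : Type*} [DecidableEq V] {G : SimpleGraph V} {v w : V} (h : G.Adj v w)
    {x y : graphRealization G} (hx : x.1 = vert v) (hy : y.1 = vert w) (t : unitInterval) {k : V}
    (hv : k ≠ v) (hw : k ≠ w) : (edgePath h hx hy t).1 k = 0 := by
  change (AffineMap.lineMap (vert v) (vert w) (t : ℝ) : V → ℝ) k = 0
  simp [AffineMap.lineMap_apply, vert, hv, hw]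

lemma exists_vertex (v : Fin 3 ⊕ Fin 3) :
    ∃ x : graphRealization (completeBipartiteGraph (Fin 3) (Fin 3)), x.1 = vert v := by
  rcases v with i | j
  · exact ⟨⟨_, Set.mem_iUnion.2 ⟨⟨(.inl i, .inr 0), by simp⟩, left_mem_segment _ _ _⟩⟩, rfl⟩
  · exact ⟨⟨_, Set.mem_iUnion.2 ⟨⟨(.inl 0, .inr j), by simp⟩, right_mem_segment _ _ _⟩⟩, rfl⟩


/-- The product `(K₃,₃)^N` of `N` copies of the complete bipartite graph `K₃,₃` does not embed
topologically into `ℝ^{2N}`. -/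
theorem K33_power_not_embeddable (N : ℕ) (hN : 0 < N) :
    ¬ ∃ f : (Fin N → ↥(graphRealization (completeBipartiteGraph (Fin 3) (Fin 3)))) →
        EuclideanSpace ℝ (Fin (2 * N)),
      Topology.IsEmbedding f := by
  rintro ⟨f, hf⟩
  have : CompactSpace (graphRealization (completeBipartiteGraph (Fin 3) (Fin 3))) :=
    isCompact_iff_compactSpace.1 (isCompact_graphRealization _)
  choose x hx using exists_vertex
  have hadj : ∀ i j, (completeBipartiteGraph (Fin 3) (Fin 3)).Adj (.inl i) (.inr j) := by simp
  refine not_injective_of_paths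
    (Sep := fun x y => ∀ k, x.1 k * y.1 k = 0) ?_ ?_
    (fun i j => edgePath (hadj i j) (hx (.inl i)) (hx (.inr j))) ?_ hN
    (f := fun y => WithLp.ofLp (f y)) ((PiLp.continuous_ofLp _ _).comp hf.continuous)
    ((WithLp.ofLp_injective _).comp hf.injective)
  · simp only [Set.ofPred_forall]
    refine isClosed_iInter fun k => isClosed_eq ?_ continuous_const
    exact ((continuous_apply k).comp (continuous_subtype_val.comp continuous_fst)).mul
      ((continuous_apply k).comp (continuous_subtype_val.comp continuous_snd))
  · intro y hy
    have h₀ : ∀ k, y.1 k = 0 := fun k => mul_self_eq_zero.1 (hy k)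
    have h₁ := sum_eq_one_of_mem_graphRealization y.2
    simp [h₀] at h₁
  · intro i i' j j' hi hj s t k
    rcases k with k | k
    · rcases eq_or_ne k i with rfl | hk
      · rw [edgePath_apply (hadj i' j') _ _ t (by simpa using hi) (by simp), mul_zero]
      · rw [edgePath_apply (hadj i j) _ _ s (by simpa using hk) (by simp), zero_mul]
    · rcases eq_or_ne k j with rfl | hk
      · rw [edgePath_apply (hadj i' j') _ _ t (by simp) (by simpa using hj), mul_zero]
      · rw [edgePath_apply (hadj i j) _ _ s (by simp) (by simpa using hk), zero_mul]
end
end
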